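/- arXiv:1404.1016 — 4 statements merged into one kernel-verified Lean document; each statement's English description precedes it below -/
import Mathlib

section
/- Let F be a non-trivial self-similar set in ℝ. If the defining IFS does not satisfy the weak separation property, then the Assouad dimension of F equals 1. -/
open Set Metric Filter Function MeasureTheory

/-- The Assouad dimension of a subset of a metric space: the infimum of all `s ≥ 0`
for which there is a constant `K > 0` such that for all `0 < ρ < r ≤ 1`, every ball
of radius `r` centred in the set can be covered by at most `K (r/ρ)^s` open balls of
radius `ρ`. -/
noncomputable def assouadDim {X : Type*} [MetricSpace X] (A : Set X) : ℝ :=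
  sInf {s : ℝ | 0 ≤ s ∧ ∃ K : ℝ, 0 < K ∧ ∀ r ρ : ℝ, 0 < ρ → ρ < r → r ≤ 1 →
    ∀ x ∈ A, ∃ t : Finset X, (A ∩ Metric.ball x r ⊆ ⋃ y ∈ t, Metric.ball y ρ) ∧
      (t.card : ℝ) ≤ K * (r / ρ) ^ s}

/-- The composition `S_{i₁} ∘ ⋯ ∘ S_{i_k}` associated to a finite word. -/
def wordMap {ι X : Type*} (S : ι → X → X) : List ι → X → X
  | [] => id
  | i :: w => S i ∘ wordMap S w

/-- The weak separation property: the identity is not in the closure (for the topology of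
pointwise convergence) of the set of maps `S_α⁻¹ ∘ S_β` for distinct nonempty words
`α ≠ β`, with the identity itself removed. -/
def SatisfiesWSP {ι X : Type*} [Nonempty X] [TopologicalSpace X] (S : ι → X → X) : Prop :=
  id ∉ closure ({g : X → X | ∃ w₁ w₂ : List ι, w₁ ≠ [] ∧ w₂ ≠ [] ∧ w₁ ≠ w₂ ∧
      g = Function.invFun (wordMap S w₁) ∘ wordMap S w₂} \ {id})

/-- `x ↦ a * x + b` is an invertible, non-expanding affine map sending `F` into itself. -/
structure IsAffineSelfMap (F : Set ℝ) (a b : ℝ) : Prop where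
  ne_zero : a ≠ 0
  abs_le_one : |a| ≤ 1
  mapsTo : ∀ x ∈ F, a * x + b ∈ F

lemma IsAffineSelfMap.comp {F : Set ℝ} {a b p q : ℝ} (h : IsAffineSelfMap F a b)
    (h' : IsAffineSelfMap F p q) : IsAffineSelfMap F (a * p) (a * q + b) where
  ne_zero := mul_ne_zero h.ne_zero h'.ne_zero
  abs_le_one := by
    rw [abs_mul]
    exact mul_le_one₀ h.abs_le_one (abs_nonneg _) h'.abs_le_one
  mapsTo x hx := by
    have := h.mapsTo _ (h'.mapsTo x hx)
    rwa [show a * p * x + (a * q + b) = a * (p * x + q) + b by ring]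

/-- A similarity of the line is affine. -/
lemma exists_affine_of_dist_eq {f : ℝ → ℝ} {c : ℝ} (hc : 0 < c)
    (hf : ∀ x y, dist (f x) (f y) = c * dist x y) :
    ∃ p q : ℝ, |p| = c ∧ ∀ x, f x = p * x + q := by
  have hp : |f 1 - f 0| = c := by simpa [Real.dist_eq] using hf 1 0
  refine ⟨f 1 - f 0, f 0, hp, fun x => ?_⟩
  have h0 := hf x 0
  have h1 := hf x 1
  rw [Real.dist_eq, Real.dist_eq] at h0 h1
  have e0 : (f x - f 0) ^ 2 = c ^ 2 * x ^ 2 := by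
    rw [← sq_abs, h0, mul_pow, sq_abs, sub_zero]
  have e1 : (f x - f 1) ^ 2 = c ^ 2 * (x - 1) ^ 2 := by
    rw [← sq_abs, h1, mul_pow, sq_abs]
  have e2 : (f 1 - f 0) ^ 2 = c ^ 2 := by rw [← sq_abs, hp]
  have hne : f 1 - f 0 ≠ 0 := by
    intro h
    rw [h, abs_zero] at hp
    exact hc.ne hp
  have : (f 1 - f 0) * (f x - f 0 - (f 1 - f 0) * x) = 0 := by
    linear_combination (1 / 2) * e0 - (1 / 2) * e1 + (1 / 2 - x) * e2
  rcases mul_eq_zero.mp this with h | h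
  · exact absurd h hne
  · linarith

lemma exists_affine_wordMap {ι : Type*} {S : ι → ℝ → ℝ} {F : Set ℝ}
    (hS : ∀ i, ∃ p q : ℝ, IsAffineSelfMap F p q ∧ ∀ x, S i x = p * x + q) (w : List ι) :
    ∃ a b : ℝ, IsAffineSelfMap F a b ∧ ∀ x, wordMap S w x = a * x + b := by
  induction w with
  | nil => exact ⟨1, 0, ⟨one_ne_zero, by simp, by simp⟩, by simp [wordMap]⟩
  | cons i w ih =>
    obtain ⟨a, b, h, e⟩ := ih
    obtain ⟨p, q, h', e'⟩ := hS i
    exact ⟨_, _, h'.comp h, fun x => by simp only [wordMap, Function.comp, e, e']; ring⟩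

/-- If the weak separation property fails, there are pairs of distinct affine self-maps `A`, `B`
of `F` such that `A⁻¹ ∘ B` is arbitrarily close to the identity. -/
lemma exists_pair_of_not_wsp {ι : Type*} {S : ι → ℝ → ℝ} {F : Set ℝ}
    (hS : ∀ i, ∃ p q : ℝ, IsAffineSelfMap F p q ∧ ∀ x, S i x = p * x + q)
    (hWSP : ¬ SatisfiesWSP S) {ε : ℝ} (hε : 0 < ε) :
    ∃ a b a' b' : ℝ, IsAffineSelfMap F a b ∧ IsAffineSelfMap F a' b' ∧
      (a' - a ≠ 0 ∨ b' - b ≠ 0) ∧ |(a' - a) / a| < ε ∧ |(b' - b) / a| < ε := by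
  rw [SatisfiesWSP, not_not, _root_.mem_closure_iff] at hWSP
  have hopen : IsOpen {g : ℝ → ℝ | |g 0| < ε / 2 ∧ |g 1 - 1| < ε / 2} := by
    rw [Set.ofPred_and]
    exact (isOpen_lt (by fun_prop) (by fun_prop)).inter (isOpen_lt (by fun_prop) (by fun_prop))
  obtain ⟨g, ⟨hg0, hg1⟩, ⟨w, w', -, -, -, rfl⟩, hne⟩ := hWSP _ hopen (by simp [hε])
  obtain ⟨a, b, h, e⟩ := exists_affine_wordMap hS w
  obtain ⟨a', b', h', e'⟩ := exists_affine_wordMap hS w'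
  have ha := h.ne_zero
  have hsurj : Function.Surjective (wordMap S w) := fun y =>
    ⟨(y - b) / a, by rw [e]; field_simp; ring⟩
  have hg : ∀ x, (Function.invFun (wordMap S w) ∘ wordMap S w') x
      = x + ((a' - a) * x + (b' - b)) / a := by
    intro x
    have := Function.rightInverse_invFun hsurj (wordMap S w' x)
    rw [e, e'] at this
    simp only [Function.comp, e']
    field_simp
    linear_combination this
  refine ⟨a, b, a', b', h, h', ?_, ?_, ?_⟩
  · by_contra! hcon
    refine hne (Set.mem_singleton_iff.mpr (funext fun x => ?_))
    rw [hg, hcon.1, hcon.2]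
    simp
  · rw [hg] at hg0 hg1
    have : (a' - a) / a = (1 + ((a' - a) * 1 + (b' - b)) / a - 1)
        - (0 + ((a' - a) * 0 + (b' - b)) / a) := by ring
    rw [this]
    exact (abs_sub _ _).trans_lt (by linarith)
  · rw [hg] at hg0
    simp only [mul_zero, zero_add] at hg0
    linarith

/-- Composing a pair of self-maps of `F` with maps of the IFS magnifies the relative displacement
at a point of `F` until it has a prescribed size, without changing the relative slope. -/
lemma exists_pair_displacement {F : Set ℝ} {k M L : ℝ} (hk : 0 < k) (hM : 0 < M) (hL : 0 < L)
    (hF : ∀ y ∈ F, ∃ p q, IsAffineSelfMap F p q ∧ k ≤ |p| ∧ |p| ≤ M ∧ ∃ z ∈ F, p * z + q = y)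
    (N : ℕ) : ∀ (a b a' b' y : ℝ), IsAffineSelfMap F a b → IsAffineSelfMap F a' b' → y ∈ F →
      L * M ^ N ≤ |((a' - a) * y + (b' - b)) / a| →
      |((a' - a) * y + (b' - b)) / a| ≤ L / k →
      ∃ α β α' β' z : ℝ, IsAffineSelfMap F α β ∧ IsAffineSelfMap F α' β' ∧ z ∈ F ∧
        (α' - α) / α = (a' - a) / a ∧
        L ≤ |((α' - α) * z + (β' - β)) / α| ∧ |((α' - α) * z + (β' - β)) / α| ≤ L / k := by
  induction N with
  | zero =>
    intro a b a' b' y h h' hy h1 h2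
    exact ⟨a, b, a', b', y, h, h', hy, rfl, by simpa using h1, h2⟩
  | succ N ih =>
    intro a b a' b' y h h' hy h1 h2
    rcases le_or_gt L |((a' - a) * y + (b' - b)) / a| with hle | hlt
    · exact ⟨a, b, a', b', y, h, h', hy, rfl, hle, h2⟩
    · obtain ⟨p, q, hpq, hkp, hpM, z, hz, rfl⟩ := hF y hy
      have ha := h.ne_zero
      have hp := hpq.ne_zero
      have hp' : 0 < |p| := abs_pos.mpr hp
      have key : |((a' * p - a * p) * z + (a' * q + b' - (a * q + b))) / (a * p)|
          = |((a' - a) * (p * z + q) + (b' - b)) / a| / |p| := by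
        rw [← abs_div]
        congr 1
        field_simp
        ring
      obtain ⟨α, β, α', β', t, g1, g2, g3, g4, g5⟩ :=
        ih (a * p) (a * q + b) (a' * p) (a' * q + b') z (h.comp hpq) (h'.comp hpq) hz
          (by
            rw [key, le_div_iff₀ hp']
            calc L * M ^ N * |p| ≤ L * M ^ N * M := by gcongr
              _ = L * M ^ (N + 1) := by ring
              _ ≤ _ := h1)
          (by rw [key]; exact div_le_div₀ hL.le hlt.le hk hkp)
      refine ⟨α, β, α', β', t, g1, g2, g3, g4.trans ?_, g5⟩
      field_simp

/-- If distinct pairs of self-maps `A`, `B` with `A⁻¹ ∘ B` close to the identity exist, then some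
pair has relative displacement comparable to any prescribed `l ≠ 0`, uniformly on `F`. -/
lemma exists_pair_uniform {F : Set ℝ} {k M : ℝ} (hk : 0 < k) (hk1 : k ≤ 1) (hM : 0 < M)
    (hM1 : M < 1) (hFb : Bornology.IsBounded F) (hFnt : F.Nontrivial)
    (hF : ∀ y ∈ F, ∃ p q, IsAffineSelfMap F p q ∧ k ≤ |p| ∧ |p| ≤ M ∧ ∃ z ∈ F, p * z + q = y)
    (hpair : ∀ ε > 0, ∃ a b a' b' : ℝ, IsAffineSelfMap F a b ∧ IsAffineSelfMap F a' b' ∧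
      (a' - a ≠ 0 ∨ b' - b ≠ 0) ∧ |(a' - a) / a| < ε ∧ |(b' - b) / a| < ε)
    {l : ℝ} (hl : l ≠ 0) :
    ∃ a b a' b' : ℝ, IsAffineSelfMap F a b ∧ IsAffineSelfMap F a' b' ∧
      ∀ x ∈ F, 1 ≤ ((a' * x + b') - (a * x + b)) / (a * l) ∧
        ((a' * x + b') - (a * x + b)) / (a * l) ≤ 8 / k := by
  obtain ⟨R, hR0, hR⟩ := hFb.exists_pos_norm_le
  simp only [Real.norm_eq_abs] at hR
  have hl' : 0 < |l| := abs_pos.mpr hl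
  set ε := min (1 / 2) (|l| / (2 * R + 1)) with hεdef
  have hε : 0 < ε := by positivity
  have hε2 : ε ≤ 1 / 2 := min_le_left _ _
  have hεl : ε * (2 * R + 1) ≤ |l| := by
    rw [← le_div_iff₀ (by positivity)]
    exact min_le_right _ _
  obtain ⟨a, b, a', b', h, h', hne, hs, ht⟩ := hpair ε hε
  have ha := h.ne_zero
  obtain ⟨y, hy, hy0⟩ : ∃ y ∈ F, (a' - a) * y + (b' - b) ≠ 0 := by
    obtain ⟨u, hu, v, hv, huv⟩ := hFnt
    by_contra! hcon
    have h1 := hcon u hu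
    have h2 := hcon v hv
    have h3 : (a' - a) * (u - v) = 0 := by linear_combination h1 - h2
    have h4 : a' - a = 0 := (mul_eq_zero.mp h3).resolve_right (sub_ne_zero.mpr huv)
    rw [h4] at h1
    rcases hne with h5 | h5
    · exact h5 h4
    · exact h5 (by linarith)
  have hupper : |((a' - a) * y + (b' - b)) / a| ≤ 3 * |l| / k := by
    have e : ((a' - a) * y + (b' - b)) / a = (a' - a) / a * y + (b' - b) / a := by ring
    have h1 : |((a' - a) * y + (b' - b)) / a| ≤ ε * R + ε := by
      rw [e]
      refine (abs_add_le _ _).trans (add_le_add ?_ ht.le)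
      rw [abs_mul]
      exact mul_le_mul hs.le (hR y hy) (abs_nonneg _) hε.le
    have h2 : |l| ≤ 3 * |l| / k := by
      rw [le_div_iff₀ hk]
      nlinarith
    nlinarith [mul_pos hε hR0]
  have hd : 0 < |((a' - a) * y + (b' - b)) / a| := abs_pos.mpr (div_ne_zero hy0 ha)
  obtain ⟨N, hN⟩ := exists_pow_lt_of_lt_one (div_pos hd (by positivity : 0 < 3 * |l|)) hM1
  rw [lt_div_iff₀ (by positivity)] at hN
  obtain ⟨α, β, α', β', z, g, g', hz, hsl, hlo, hhi⟩ :=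
    exists_pair_displacement hk hM (by positivity : 0 < 3 * |l|) hF N a b a' b' y h h' hy
      (by linarith) hupper
  have hα := g.ne_zero
  have hα' := g'.ne_zero
  rw [← hsl] at hs
  set η := (α' - α) / α with hη
  set d := ((α' - α) * z + (β' - β)) / α with hd_def
  have hηa := abs_lt.mp hs
  have hη1 : α' = α * (1 + η) := by rw [hη]; field_simp; ring
  have hpos : 0 < 1 + η := by linarith
  have hD : ∀ x ∈ F, |((α' * x + β') - (α * x + β)) / α - d| ≤ |l| := by
    intro x hx
    have e : ((α' * x + β') - (α * x + β)) / α - d = η * (x - z) := by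
      rw [hη, hd_def]
      field_simp
      ring
    rw [e, abs_mul]
    calc |η| * |x - z| ≤ ε * (2 * R) := by
          refine mul_le_mul hs.le ?_ (abs_nonneg _) hε.le
          exact (abs_sub _ _).trans (by linarith [hR x hx, hR z hz])
      _ ≤ |l| := by nlinarith
  have hlk : |l| ≤ |l| / k := by
    rw [le_div_iff₀ hk]
    nlinarith
  have hDl : ∀ x ∈ F, |((α' * x + β') - (α * x + β)) / α / l - d / l| ≤ 1 := by
    intro x hx
    rw [← sub_div, abs_div, div_le_one hl']
    exact hD x hx
  have hlo' : 3 ≤ |d / l| := by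
    rw [abs_div, le_div_iff₀ hl']
    exact hlo
  have hhi' : |d / l| ≤ 3 * (1 / k) := by
    rw [abs_div, div_le_iff₀ hl']
    calc |d| ≤ _ := hhi
      _ = _ := by ring
  have hk' : 1 ≤ 1 / k := by rwa [le_div_iff₀ hk, one_mul]
  have h8 : 8 / k = 8 * (1 / k) := by ring
  rw [h8]
  rcases le_total 0 (d / l) with hsgn | hsgn
  · refine ⟨α, β, α', β', g, g', fun x hx => ?_⟩
    have := abs_le.mp (hDl x hx)
    rw [abs_of_nonneg hsgn] at hlo' hhi'
    rw [← div_div]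
    constructor <;> linarith
  · refine ⟨α', β', α, β, g', g, fun x hx => ?_⟩
    have := abs_le.mp (hDl x hx)
    rw [abs_of_nonpos hsgn] at hlo' hhi'
    have e : ((α * x + β) - (α' * x + β')) / (α' * l)
        = -(((α' * x + β') - (α * x + β)) / α / l) / (1 + η) := by
      have := hpos.ne'
      rw [hη1]
      field_simp
      ring
    rw [e, le_div_iff₀ hpos, div_le_iff₀ hpos]
    constructor
    · linarith
    · nlinarith

/-- Arbitrarily long and arbitrarily small approximate arithmetic progressions in `F`. -/
lemma exists_chain {F : Set ℝ} {C : ℝ} (hne : F.Nonempty)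
    (hF : ∀ l : ℝ, l ≠ 0 → ∃ a b a' b' : ℝ, IsAffineSelfMap F a b ∧ IsAffineSelfMap F a' b' ∧
      ∀ x ∈ F, 1 ≤ ((a' * x + b') - (a * x + b)) / (a * l) ∧
        ((a' * x + b') - (a * x + b)) / (a * l) ≤ C)
    {ε : ℝ} (hε : 0 < ε) (n : ℕ) :
    ∃ (f : ℕ → ℝ) (l : ℝ), l ≠ 0 ∧ |l| ≤ ε ∧ (∀ j ≤ n, f j ∈ F) ∧
      ∀ j < n, 1 ≤ (f (j + 1) - f j) / l ∧ (f (j + 1) - f j) / l ≤ C := by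
  induction n with
  | zero =>
    obtain ⟨x, hx⟩ := hne
    exact ⟨fun _ => x, ε, hε.ne', (abs_of_pos hε).le, fun _ _ => hx, by simp⟩
  | succ n ih =>
    obtain ⟨f, l, hl, hlε, hf, hgap⟩ := ih
    obtain ⟨a, b, a', b', h, h', hD⟩ := hF l hl
    have ha := h.ne_zero
    refine ⟨fun j => if j ≤ n then a * f j + b else a' * f n + b', a * l, mul_ne_zero ha hl, ?_,
      ?_, ?_⟩
    · rw [abs_mul]
      nlinarith [h.abs_le_one, abs_nonneg l]
    · intro j _
      dsimp only
      split_ifs with hj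
      · exact h.mapsTo _ (hf j hj)
      · exact h'.mapsTo _ (hf n le_rfl)
    · intro j hj
      dsimp only
      rcases Nat.lt_succ_iff_lt_or_eq.mp hj with hlt | rfl
      · rw [if_pos (show j + 1 ≤ n from hlt), if_pos hlt.le,
          show a * f (j + 1) + b - (a * f j + b) = a * (f (j + 1) - f j) by ring,
          mul_div_mul_left _ _ ha]
        exact hgap j hlt
      · rw [if_neg (by omega), if_pos le_rfl]
        exact hD _ (hf j le_rfl)

lemma chain_bounds {h : ℕ → ℝ} {C : ℝ} {n : ℕ}
    (hh : ∀ j < n, 1 ≤ h (j + 1) - h j ∧ h (j + 1) - h j ≤ C) (i m : ℕ) (him : i + m ≤ n) :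
    (m : ℝ) ≤ h (i + m) - h i ∧ h (i + m) - h i ≤ C * m := by
  induction m with
  | zero => simp
  | succ m ih =>
    have h1 := ih (by omega)
    have h2 := hh (i + m) (by omega)
    rw [← add_assoc]
    push_cast
    constructor <;> linarith

lemma exists_cover_real {x r ρ : ℝ} (hρ : 0 < ρ) (hρr : ρ < r) :
    ∃ t : Finset ℝ, Metric.ball x r ⊆ ⋃ y ∈ t, Metric.ball y ρ ∧ (t.card : ℝ) ≤ 5 * (r / ρ) := by
  have hone : 1 < r / ρ := (one_lt_div hρ).mpr hρr
  set N := ⌈r / ρ⌉₊ with hN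
  have hN1 : r / ρ ≤ N := Nat.le_ceil _
  have hN2 : (N : ℝ) < r / ρ + 1 := Nat.ceil_lt_add_one (by positivity)
  refine ⟨(Finset.Icc (-(N : ℤ)) N).image fun j : ℤ => x + j * ρ, fun z hz => ?_, ?_⟩
  · rw [Metric.mem_ball, Real.dist_eq] at hz
    have hz' : |(z - x) / ρ| < N := by
      rw [abs_div, abs_of_pos hρ]
      exact ((div_lt_div_iff_of_pos_right hρ).mpr hz).trans_le hN1
    obtain ⟨hz1, hz2⟩ := abs_lt.mp hz'
    simp only [Set.mem_iUnion, Finset.mem_image, exists_prop, Finset.mem_Icc]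
    refine ⟨_, ⟨⌊(z - x) / ρ⌋, ⟨?_, ?_⟩, rfl⟩, ?_⟩
    · rw [Int.le_floor]
      push_cast
      exact hz1.le
    · have := (Int.floor_le ((z - x) / ρ)).trans hz2.le
      exact_mod_cast this
    · have h1 := Int.floor_le ((z - x) / ρ)
      have h2 := Int.lt_floor_add_one ((z - x) / ρ)
      rw [le_div_iff₀ hρ] at h1
      rw [div_lt_iff₀ hρ] at h2
      rw [Metric.mem_ball, Real.dist_eq, abs_lt]
      constructor <;> nlinarith
  · have hcard : (Finset.Icc (-(N : ℤ)) N).card = 2 * N + 1 := by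
      rw [Int.card_Icc]
      omega
    have := Finset.card_image_le (s := Finset.Icc (-(N : ℤ)) N) (f := fun j : ℤ => x + j * ρ)
    rw [hcard] at this
    have h' : (((Finset.Icc (-(N : ℤ)) N).image fun j : ℤ => x + j * ρ).card : ℝ) ≤ 2 * N + 1 := by
      exact_mod_cast this
    linarith

lemma succ_le_card_of_cover {f : ℕ → ℝ} {l : ℝ} (hl : l ≠ 0) {n : ℕ}
    (hf : ∀ i j, i < j → j ≤ n → 1 ≤ (f j - f i) / l) {t : Finset ℝ}
    (ht : ∀ j ≤ n, f j ∈ ⋃ y ∈ t, Metric.ball y (|l| / 2)) : n + 1 ≤ t.card := by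
  simp only [Set.mem_iUnion, exists_prop] at ht
  have ht' : ∀ j : ℕ, ∃ y, j ≤ n → y ∈ t ∧ f j ∈ Metric.ball y (|l| / 2) := fun j => by
    by_cases hj : j ≤ n
    · obtain ⟨y, hy⟩ := ht j hj
      exact ⟨y, fun _ => hy⟩
    · exact ⟨0, fun h => absurd h hj⟩
  choose φ hφ using ht'
  have hl' : 0 < |l| := abs_pos.mpr hl
  have hlt : ∀ i j, i < j → j ≤ n → φ i ≠ φ j := by
    intro i j hij hj he
    have h1 := (hφ i (hij.le.trans hj)).2
    have h2 := (hφ j hj).2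
    rw [he] at h1
    have h3 : |f j - f i| < |l| := by
      rw [← Real.dist_eq]
      exact (dist_triangle_right _ _ _).trans_lt
        ((add_lt_add (Metric.mem_ball.mp h2) (Metric.mem_ball.mp h1)).trans_eq (add_halves _))
    have h4 := (hf i j hij hj).trans (le_abs_self _)
    rw [abs_div, le_div_iff₀ hl'] at h4
    linarith
  have := Finset.card_le_card_of_injOn (s := Finset.range (n + 1)) (t := t) φ
    (fun j hj => (hφ j (by simpa [Nat.lt_succ_iff] using hj)).1)
    (fun i hi j hj he => by
      simp only [Finset.coe_range, Set.mem_Iio, Nat.lt_succ_iff] at hi hj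
      rcases lt_trichotomy i j with h | h | h
      · exact absurd he (hlt i j h hj)
      · exact h
      · exact absurd he.symm (hlt j i h hi))
  simpa using this

lemma one_le_of_forall_succ_le {K D s : ℝ} (hD : 0 < D)
    (h : ∀ n : ℕ, (n : ℝ) + 1 ≤ K * (D * (n + 1)) ^ s) : 1 ≤ s := by
  by_contra! hs
  obtain ⟨n, hn⟩ := (((tendsto_rpow_atTop (sub_pos.mpr hs)).comp
    ((tendsto_natCast_atTop_atTop (R := ℝ)).comp (tendsto_add_atTop_nat 1))).eventually_gt_atTop
      (K * D ^ s)).exists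
  simp only [Function.comp, Nat.cast_add, Nat.cast_one] at hn
  have hn0 : (0 : ℝ) < n + 1 := by positivity
  have h1 := h n
  rw [Real.mul_rpow hD.le hn0.le] at h1
  have h2 : ((n : ℝ) + 1) ^ (1 - s) * ((n : ℝ) + 1) ^ s = n + 1 := by
    rw [← Real.rpow_add hn0, sub_add_cancel, Real.rpow_one]
  have h3 : (0 : ℝ) < ((n : ℝ) + 1) ^ s := Real.rpow_pos_of_pos hn0 _
  nlinarith [mul_lt_mul_of_pos_right hn h3]

lemma assouadDim_eq_one_of_chains {F : Set ℝ} {C : ℝ} (hC : 1 ≤ C)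
    (hF : ∀ ε > 0, ∀ n : ℕ, ∃ (f : ℕ → ℝ) (l : ℝ), l ≠ 0 ∧ |l| ≤ ε ∧ (∀ j ≤ n, f j ∈ F) ∧
      ∀ j < n, 1 ≤ (f (j + 1) - f j) / l ∧ (f (j + 1) - f j) / l ≤ C) :
    assouadDim F = 1 := by
  refine IsLeast.csInf_eq ⟨⟨zero_le_one, 5, by norm_num, fun r ρ hρ hρr _ x _ => ?_⟩, ?_⟩
  · obtain ⟨t, ht, hcard⟩ := exists_cover_real (x := x) hρ hρr
    exact ⟨t, Set.inter_subset_right.trans ht, by rwa [Real.rpow_one]⟩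
  · rintro s ⟨-, K, -, hK⟩
    refine one_le_of_forall_succ_le (K := K) (D := 2 * C) (by positivity) fun n => ?_
    have hn : (0 : ℝ) < n + 1 := by positivity
    obtain ⟨f, l, hl, hlε, hf, hgap⟩ := hF (1 / (C * (n + 1))) (by positivity) n
    have hl' : 0 < |l| := abs_pos.mpr hl
    have hb := chain_bounds (h := fun j => f j / l) (C := C) (n := n) (by
      intro j hj
      rw [← sub_div]
      exact hgap j hj)
    rw [le_div_iff₀ (by positivity)] at hlε
    obtain ⟨t, ht, hcard⟩ := hK (C * (n + 1) * |l|) (|l| / 2) (by positivity)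
      (by nlinarith [mul_pos hn hl', mul_nonneg (sub_nonneg.mpr hC) (mul_pos hn hl').le,
            mul_nonneg (Nat.cast_nonneg (α := ℝ) n) hl'.le])
      (by linarith) (f 0) (hf 0 (Nat.zero_le _))
    have hle : n + 1 ≤ t.card := by
      refine succ_le_card_of_cover hl ?_ fun j hj => ht ⟨hf j hj, ?_⟩
      · intro i j hij hj
        obtain ⟨m, rfl⟩ := Nat.exists_eq_add_of_lt hij
        have := (hb i (m + 1) (by omega)).1
        rw [← sub_div, ← add_assoc] at this
        push_cast at this
        linarith [Nat.cast_nonneg (α := ℝ) m]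
      · obtain ⟨h1, h2⟩ := hb 0 j (by omega)
        rw [zero_add, ← sub_div] at h1 h2
        have hj' : (j : ℝ) ≤ n := by exact_mod_cast hj
        have h3 : |(f j - f 0) / l| < C * (n + 1) := by
          rw [abs_of_nonneg ((Nat.cast_nonneg j).trans h1)]
          nlinarith
        rw [abs_div, div_lt_iff₀ hl'] at h3
        rwa [Metric.mem_ball, Real.dist_eq]
    have e : C * (n + 1) * |l| / (|l| / 2) = 2 * C * (n + 1) := by
      field_simp
    rw [e] at hcard
    refine le_trans ?_ hcard
    exact_mod_cast hle

/-- **Failure of WSP on the line forces maximal Assouad dimension.**  Let `F` be a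
non-trivial self-similar set in `ℝ`, attractor of an IFS of contracting similarities.
If the IFS does not satisfy the weak separation property, then `dim_A F = 1`. -/
theorem assouad_eq_one_of_not_wsp_line {ι : Type} [Fintype ι] [Nonempty ι]
    (S : ι → ℝ → ℝ) (c : ι → ℝ)
    (hc : ∀ i, c i ∈ Set.Ioo (0 : ℝ) 1)
    (hsim : ∀ i x y, dist (S i x) (S i y) = c i * dist x y)
    (F : Set ℝ) (hFcomp : IsCompact F) (hFne : F.Nonempty)
    (hFattr : F = ⋃ i, S i '' F)
    (hFnt : F.Nontrivial)
    (hWSP : ¬ SatisfiesWSP S) :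
    assouadDim F = 1 := by
  have hS : ∀ i, ∃ p q : ℝ, IsAffineSelfMap F p q ∧ |p| = c i ∧ ∀ x, S i x = p * x + q := by
    intro i
    obtain ⟨p, q, hp, e⟩ := exists_affine_of_dist_eq (hc i).1 (hsim i)
    refine ⟨p, q, ⟨abs_pos.mp (hp ▸ (hc i).1), hp.trans_le (hc i).2.le, fun x hx => ?_⟩, hp, e⟩
    rw [← e, hFattr]
    exact Set.mem_iUnion.mpr ⟨i, x, hx, rfl⟩
  obtain ⟨i₀, hi₀⟩ := Finite.exists_min c
  obtain ⟨i₁, hi₁⟩ := Finite.exists_max c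
  have hk := (hc i₀).1
  have hk1 := (hc i₀).2.le
  refine assouadDim_eq_one_of_chains (C := 8 / c i₀) (by rw [le_div_iff₀ hk]; linarith)
    fun ε hε n => exists_chain hFne (fun l hl => ?_) hε n
  refine exists_pair_uniform hk hk1 (hc i₁).1 (hc i₁).2 hFcomp.isBounded hFnt ?_ ?_ hl
  · intro y hy
    rw [hFattr] at hy
    obtain ⟨i, z, hz, rfl⟩ := Set.mem_iUnion.mp hy
    obtain ⟨p, q, h, hp, e⟩ := hS i
    exact ⟨p, q, h, hp ▸ hi₀ i, hp ▸ hi₁ i, z, hz, (e z).symm⟩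
  · intro ε hε
    refine exists_pair_of_not_wsp (fun i => ?_) hWSP hε
    obtain ⟨p, q, h, -, e⟩ := hS i
    exact ⟨p, q, h, e⟩
end

section
/- Let F be a self-similar set in ℝ^d not contained in any (d−1)-dimensional hyperplane. If the defining IFS does not satisfy the weak separation property, then the Assouad dimension of F is at least 1. -/
open Set Metric Filter Function MeasureTheory

section Doubling

variable {E : Type*} [NormedAddCommGroup E] [NormedSpace ℝ E] [FiniteDimensional ℝ E]

/-- In a finite-dimensional normed space, every ball is covered by at most `M ^ n` balls whose
radius is smaller by the factor `2 ^ n`. -/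
theorem exists_card_cover_ball_le_pow :
    ∃ M : ℕ, 0 < M ∧ ∀ (n : ℕ) (r : ℝ), 0 < r → ∀ x : E, ∃ t : Finset E,
      ball x r ⊆ ⋃ y ∈ t, ball y (r / 2 ^ n) ∧ t.card ≤ M ^ n := by
  classical
  have : ProperSpace E := FiniteDimensional.proper ℝ E
  obtain ⟨s, -, hsfin, hs⟩ := (isCompact_closedBall (0 : E) 1).finite_cover_balls
    (e := 1 / 2) (by norm_num)
  lift s to Finset E using hsfin
  refine ⟨s.card + 1, Nat.succ_pos _, fun n => ?_⟩
  induction n with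
  | zero => exact fun r _ x => ⟨{x}, by simp, by simp⟩
  | succ n ih =>
    intro r hr x
    choose u hu hcard using ih (r / 2) (by positivity)
    refine ⟨s.biUnion fun y => u (x + r • y), fun z hz => ?_, ?_⟩
    · have hmem : r⁻¹ • (z - x) ∈ closedBall (0 : E) 1 := by
        rw [mem_closedBall_zero_iff, norm_smul, norm_inv, Real.norm_of_nonneg hr.le,
          ← dist_eq_norm, inv_mul_le_iff₀ hr, mul_one]
        exact (mem_ball.1 hz).le
      obtain ⟨y, hy, hzy⟩ := mem_iUnion₂.1 (hs hmem)
      have hz' : z ∈ ball (x + r • y) (r / 2) := by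
        have hdecomp : z - (x + r • y) = r • (r⁻¹ • (z - x) - y) := by
          rw [smul_sub, smul_inv_smul₀ hr.ne']; abel
        rw [mem_ball, dist_eq_norm] at hzy ⊢
        rw [hdecomp, norm_smul, Real.norm_of_nonneg hr.le]
        nlinarith
      obtain ⟨v, hv, hzv⟩ := mem_iUnion₂.1 (hu _ hz')
      refine mem_iUnion₂.2 ⟨v, Finset.mem_biUnion.2 ⟨y, hy, hv⟩, ?_⟩
      rwa [pow_succ', ← div_div]
    · calc (s.biUnion fun y => u (x + r • y)).card
          ≤ s.card * (s.card + 1) ^ n := Finset.card_biUnion_le_card_mul _ _ _ fun y _ => hcard _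
        _ ≤ (s.card + 1) ^ (n + 1) := by
          rw [pow_succ']; exact Nat.mul_le_mul_right _ (Nat.le_succ _)

theorem exists_covering_exponent (A : Set E) :
    ∃ s : ℝ, 0 ≤ s ∧ ∃ K : ℝ, 0 < K ∧ ∀ r ρ : ℝ, 0 < ρ → ρ < r → r ≤ 1 →
      ∀ x ∈ A, ∃ t : Finset E, (A ∩ ball x r ⊆ ⋃ y ∈ t, ball y ρ) ∧
        (t.card : ℝ) ≤ K * (r / ρ) ^ s := by
  obtain ⟨M, hM, hcover⟩ := exists_card_cover_ball_le_pow (E := E)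
  have hM1 : (1 : ℝ) ≤ M := by exact_mod_cast hM
  have hs : 0 ≤ Real.logb 2 M := Real.logb_nonneg (by norm_num) hM1
  refine ⟨Real.logb 2 M, hs, M, by positivity, fun r ρ hρ hρr _ x _ => ?_⟩
  have hratio : 1 ≤ r / ρ := (one_le_div hρ).2 hρr.le
  obtain ⟨n, hn, hn'⟩ := exists_nat_pow_near hratio (one_lt_two : (1 : ℝ) < 2)
  obtain ⟨t, ht, htcard⟩ := hcover (n + 1) r (hρ.trans hρr) x
  refine ⟨t, inter_subset_right.trans (ht.trans (iUnion₂_mono fun y _ => ball_subset_ball ?_)), ?_⟩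
  · rw [div_lt_iff₀ hρ] at hn'
    rw [div_le_iff₀ (by positivity)]
    linarith
  · calc (t.card : ℝ) ≤ (M : ℝ) ^ (n + 1) := by exact_mod_cast htcard
      _ = M * ((2 : ℝ) ^ n) ^ Real.logb 2 M := by
        rw [pow_succ', ← Real.rpow_natCast_mul (by norm_num), mul_comm (n : ℝ), Real.rpow_mul
          (by norm_num), Real.rpow_logb (by norm_num) (by norm_num) (by positivity),
          Real.rpow_natCast]
      _ ≤ M * (r / ρ) ^ Real.logb 2 M := by gcongr

end Doubling

section Similarities

variable {E : Type*} [NormedAddCommGroup E] [InnerProductSpace ℝ E] [FiniteDimensional ℝ E]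

theorem exists_affineEquiv_of_similarity {f : E → E} {r : ℝ} (hr : 0 < r)
    (hf : ∀ x y, dist (f x) (f y) = r * dist x y) : ∃ T : E ≃ᵃ[ℝ] E, ⇑T = f := by
  have hiso : Isometry fun x => r⁻¹ • f x := Isometry.of_dist_eq fun x y => by
    rw [dist_smul₀, hf, norm_inv, Real.norm_of_nonneg hr.le, inv_mul_cancel_left₀ hr.ne']
  have : Inhabited E := ⟨0⟩
  refine ⟨(hiso.affineIsometryOfStrictConvexSpace.toAffineIsometryEquiv rfl).toAffineEquiv.trans
    (LinearEquiv.smulOfNeZero ℝ E r hr.ne').toAffineEquiv, funext fun x => ?_⟩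
  simp [hr.ne']

end Similarities

section Displacement

variable {κ E : Type*} [Fintype κ] [NormedAddCommGroup E] [NormedSpace ℝ E]

/-- The displacements of the points of an affine basis under an affine equivalence. -/
def displacement (b : AffineBasis κ ℝ E) (h : E ≃ᵃ[ℝ] E) : κ → E := fun i => h (b i) - b i

theorem sub_self_eq_sum_coord_smul_displacement (b : AffineBasis κ ℝ E) (h : E ≃ᵃ[ℝ] E) (y : E) :
    h y - y = ∑ i, b.coord i y • displacement b h i := by
  have hw := b.sum_coord_apply_eq_one y
  have h1 := b.linear_combination_coord_eq_self y
  have h2 : h y = ∑ i, b.coord i y • h (b i) := by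
    conv_lhs => rw [← b.affineCombination_coord_eq_self y]
    have := Finset.univ.map_affineCombination b (fun i => b.coord i y) hw h.toAffineMap
    rw [Finset.affineCombination_eq_linear_combination _ _ _ hw] at this ⊢
    simpa [Finset.affineCombination_eq_linear_combination _ _ _ hw] using this
  simp only [displacement, smul_sub, Finset.sum_sub_distrib, h1, ← h2]

theorem exists_lipschitz_displacement [FiniteDimensional ℝ E] (b : AffineBasis κ ℝ E) :
    ∃ L : ℝ, 0 ≤ L ∧ ∀ (h : E ≃ᵃ[ℝ] E) (y z : E),
      ‖(h y - y) - (h z - z)‖ ≤ L * ‖displacement b h‖ * dist y z := by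
  refine ⟨∑ i, ‖(b.coord i).linear.toContinuousLinearMap‖, by positivity, fun h y z => ?_⟩
  rw [sub_self_eq_sum_coord_smul_displacement b, sub_self_eq_sum_coord_smul_displacement b,
    ← Finset.sum_sub_distrib, Finset.sum_mul, Finset.sum_mul]
  refine norm_sum_le_of_le _ fun i _ => ?_
  rw [← sub_smul, norm_smul, mul_right_comm]
  gcongr
  · rw [dist_eq_norm, ← vsub_eq_sub (b.coord i y), ← AffineMap.linearMap_vsub, vsub_eq_sub]
    exact (b.coord i).linear.toContinuousLinearMap.le_opNorm (y - z)
  · exact norm_le_pi_norm _ i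

theorem displacement_eq_zero_iff (b : AffineBasis κ ℝ E) (h : E ≃ᵃ[ℝ] E) :
    displacement b h = 0 ↔ h = 1 := by
  refine ⟨fun h0 => AffineEquiv.ext fun y => ?_, ?_⟩
  · have := sub_self_eq_sum_coord_smul_displacement b h y
    rw [h0] at this
    simpa [sub_eq_zero] using this
  · rintro rfl
    ext i
    simp [displacement]

theorem exists_norm_displacement_eq (b : AffineBasis κ ℝ E) (a : κ → E) :
    ∃ i, ‖a i‖ = ‖a‖ := by
  have : Nonempty κ := b.nonempty
  obtain ⟨i, hi⟩ := Finite.exists_max fun i => ‖a i‖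
  exact ⟨i, le_antisymm (norm_le_pi_norm a i) ((pi_norm_le_iff_of_nonneg (norm_nonneg _)).2 hi)⟩

end Displacement

section Words

variable {ι E : Type*} [NormedAddCommGroup E] [NormedSpace ℝ E]

/-- The affine equivalence associated to a finite word. -/
def wordEquiv (T : ι → E ≃ᵃ[ℝ] E) (w : List ι) : E ≃ᵃ[ℝ] E := (w.map T).prod

theorem wordEquiv_cons (T : ι → E ≃ᵃ[ℝ] E) (i : ι) (w : List ι) :
    wordEquiv T (i :: w) = T i * wordEquiv T w := by
  simp [wordEquiv]

theorem wordEquiv_append (T : ι → E ≃ᵃ[ℝ] E) (v w : List ι) :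
    wordEquiv T (v ++ w) = wordEquiv T v * wordEquiv T w := by
  simp [wordEquiv]

theorem coe_wordEquiv {S : ι → E → E} {T : ι → E ≃ᵃ[ℝ] E} (hTS : ∀ i, ⇑(T i) = S i)
    (w : List ι) : ⇑(wordEquiv T w) = wordMap S w := by
  induction w with
  | nil => simp [wordEquiv, wordMap]
  | cons i w ih => rw [wordEquiv_cons, AffineEquiv.coe_mul, hTS, ih, wordMap]

theorem wordRatio_pos {c : ι → ℝ} (hc : ∀ i, 0 < c i) (w : List ι) : 0 < (w.map c).prod :=
  List.prod_pos fun x hx => by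
    obtain ⟨i, -, rfl⟩ := List.mem_map.1 hx
    exact hc i

theorem wordRatio_le_one {c : ι → ℝ} (hc : ∀ i, c i ∈ Ioo (0 : ℝ) 1) (w : List ι) :
    (w.map c).prod ≤ 1 := by
  induction w with
  | nil => simp
  | cons i w ih =>
    rw [List.map_cons, List.prod_cons]
    exact mul_le_one₀ (hc i).2.le (wordRatio_pos (fun i => (hc i).1) w).le ih

theorem dist_wordEquiv {T : ι → E ≃ᵃ[ℝ] E} {c : ι → ℝ}
    (hT : ∀ i x y, dist (T i x) (T i y) = c i * dist x y) (w : List ι) (x y : E) :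
    dist (wordEquiv T w x) (wordEquiv T w y) = (w.map c).prod * dist x y := by
  induction w with
  | nil => simp [wordEquiv]
  | cons i w ih =>
    simp only [wordEquiv_cons, AffineEquiv.coe_mul, comp_apply, hT, ih, List.map_cons,
      List.prod_cons, mul_assoc]

theorem wordEquiv_mem {T : ι → E ≃ᵃ[ℝ] E} {F : Set E} (hF : F = ⋃ i, T i '' F) (w : List ι)
    {x : E} (hx : x ∈ F) : wordEquiv T w x ∈ F := by
  induction w with
  | nil => simpa [wordEquiv]
  | cons i w ih =>
    rw [hF, wordEquiv_cons]
    exact mem_iUnion.2 ⟨i, _, ih, rfl⟩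

/-- Every point of the attractor lies in a cylinder whose ratio is comparable to a prescribed
number `τ`. -/
theorem exists_wordEquiv_ratio_comparable [Finite ι] [Nonempty ι] {T : ι → E ≃ᵃ[ℝ] E} {c : ι → ℝ}
    (hc : ∀ i, c i ∈ Ioo (0 : ℝ) 1) {F : Set E} (hF : F = ⋃ i, T i '' F) :
    ∃ m : ℝ, 0 < m ∧ ∀ τ : ℝ, 0 < τ → τ ≤ 1 → ∀ x ∈ F, ∃ u : List ι, ∃ y ∈ F,
      wordEquiv T u y = x ∧ m * τ ≤ (u.map c).prod ∧ (u.map c).prod ≤ τ := by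
  obtain ⟨i₀, hmin⟩ := Finite.exists_min c
  obtain ⟨i₁, hmax⟩ := Finite.exists_max c
  refine ⟨c i₀, (hc i₀).1, ?_⟩
  have key : ∀ (n : ℕ) (τ : ℝ), 0 < τ → τ ≤ 1 → c i₁ ^ n ≤ τ → ∀ x ∈ F, ∃ u : List ι,
      ∃ y ∈ F, wordEquiv T u y = x ∧ c i₀ * τ ≤ (u.map c).prod ∧ (u.map c).prod ≤ τ := by
    intro n
    induction n with
    | zero =>
      intro τ hτ hτ1 hn x hx
      refine ⟨[], x, hx, by simp [wordEquiv], ?_, by simpa using hn⟩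
      simpa using mul_le_one₀ (hc i₀).2.le hτ.le hτ1
    | succ n ih =>
      intro τ hτ hτ1 hn x hx
      rw [hF] at hx
      obtain ⟨i, y, hy, rfl⟩ := mem_iUnion.1 hx
      have hi := (hc i).1
      rcases le_or_gt (c i) τ with h | h
      · refine ⟨[i], y, hy, by simp [wordEquiv], ?_, by simpa using h⟩
        simpa using (mul_le_of_le_one_right (hc i₀).1.le hτ1).trans (hmin i)
      · obtain ⟨u, z, hz, hzy, h1, h2⟩ := ih (τ / c i) (by positivity) ((div_le_one hi).2 h.le)
          (by
            rw [le_div_iff₀ hi]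
            refine le_trans ?_ hn
            rw [pow_succ]
            exact mul_le_mul_of_nonneg_left (hmax i) (pow_nonneg (hc i₁).1.le n)) y hy
        refine ⟨i :: u, z, hz, by simp [wordEquiv_cons, hzy], ?_, ?_⟩
        · rw [← mul_div_assoc, div_le_iff₀ hi] at h1
          rwa [List.map_cons, List.prod_cons, mul_comm (c i)]
        · rw [le_div_iff₀ hi] at h2
          rwa [List.map_cons, List.prod_cons, mul_comm (c i)]
  intro τ hτ hτ1
  obtain ⟨n, hn⟩ := exists_pow_lt_of_lt_one hτ (hc i₁).2
  exact key n τ hτ hτ1 hn.le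

end Words

section Zoom

variable {ι κ E : Type*} [Fintype κ] [NormedAddCommGroup E] [NormedSpace ℝ E]

theorem norm_conj_wordEquiv_sub {T : ι → E ≃ᵃ[ℝ] E} {c : ι → ℝ}
    (hT : ∀ i x y, dist (T i x) (T i y) = c i * dist x y) (hc : ∀ i, 0 < c i)
    (g : E ≃ᵃ[ℝ] E) (v : List ι) (x : E) :
    ‖((wordEquiv T v)⁻¹ * g * wordEquiv T v) x - x‖ =
      ‖g (wordEquiv T v x) - wordEquiv T v x‖ / (v.map c).prod := by
  rw [eq_div_iff (wordRatio_pos hc v).ne', ← dist_eq_norm, ← dist_eq_norm, mul_comm,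
    ← dist_wordEquiv hT]
  simp [AffineEquiv.inv_def]

/-- If the identity is a limit of nontrivial maps `S_α⁻¹ ∘ S_β`, then after conjugating by words
ending in any prescribed `w` one finds such maps whose displacement has any prescribed order of
magnitude. -/
theorem exists_conj_displacement_comparable [FiniteDimensional ℝ E] [Finite ι] [Nonempty ι]
    {T : ι → E ≃ᵃ[ℝ] E} {c : ι → ℝ} (hc : ∀ i, c i ∈ Ioo (0 : ℝ) 1)
    (hT : ∀ i x y, dist (T i x) (T i y) = c i * dist x y) {F : Set E}
    (hF : F = ⋃ i, T i '' F) (hFb : Bornology.IsBounded F) (b : AffineBasis κ ℝ E)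
    (hb : ∀ i, b i ∈ F)
    (hsmall : ∀ ε > 0, ∃ p q : List ι, (wordEquiv T p)⁻¹ * wordEquiv T q ≠ 1 ∧
      ‖displacement b ((wordEquiv T p)⁻¹ * wordEquiv T q)‖ < ε) :
    ∃ k : ℝ, 0 < k ∧ ∀ (w : List ι) (δ : ℝ), 0 < δ → ∃ p q : List ι, ∃ h : E ≃ᵃ[ℝ] E,
      wordEquiv T p * wordEquiv T w * h = wordEquiv T q * wordEquiv T w ∧
      k * δ ≤ ‖displacement b h‖ ∧ ‖displacement b h‖ ≤ δ := by
  obtain ⟨m, hm, hword⟩ := exists_wordEquiv_ratio_comparable hc hF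
  obtain ⟨L, hL, hlip⟩ := exists_lipschitz_displacement b
  obtain ⟨R, hR⟩ := Metric.isBounded_iff.1 hFb
  obtain ⟨i₁⟩ : Nonempty κ := b.nonempty
  have hR0 : 0 ≤ R := dist_nonneg.trans (hR (hb i₁) (hb i₁))
  have hc0 : ∀ i, 0 < c i := fun i => (hc i).1
  have hLR : 0 ≤ L * R := mul_nonneg hL hR0
  set B : ℝ := 1 + L * R with hB
  have hBpos : 0 < B := by positivity
  refine ⟨m / (2 * B), by positivity, fun w δ hδ => ?_⟩
  set cw : ℝ := (w.map c).prod with hrw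
  have hrw0 : 0 < cw := wordRatio_pos hc0 w
  obtain ⟨p, q, hg, hgsmall⟩ := hsmall (δ * cw * m / (B * (2 * B))) (by positivity)
  set g : E ≃ᵃ[ℝ] E := (wordEquiv T p)⁻¹ * wordEquiv T q with hgdef
  set D : ℝ := ‖displacement b g‖ with hD
  have hDpos : 0 < D := norm_pos_iff.2 fun h => hg ((displacement_eq_zero_iff b g).1 h)
  obtain ⟨i₀, hi₀⟩ := exists_norm_displacement_eq b (displacement b g)
  set τ : ℝ := B * D / (m * δ * cw) with hτ
  have hτpos : 0 < τ := by positivity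
  have hτsmall : τ * (2 * B) ≤ 1 := by
    rw [lt_div_iff₀ (by positivity)] at hgsmall
    rw [hτ, div_mul_eq_mul_div, div_le_one (by positivity)]
    nlinarith
  have hτ1 : τ ≤ 1 := by nlinarith
  obtain ⟨u, y₀, hy₀, hu, hu1, hu2⟩ := hword τ hτpos hτ1 (b i₀) (hb i₀)
  have hupos : 0 < (u.map c).prod := wordRatio_pos hc0 u
  have hprod : ((u ++ w).map c).prod = (u.map c).prod * cw := by simp [hrw]
  have hprodpos : 0 < (u.map c).prod * cw := by positivity
  have hmτ : m * τ * (δ * cw) = B * D := by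
    rw [hτ]; field_simp
  refine ⟨p ++ u, q ++ u, (wordEquiv T (u ++ w))⁻¹ * g * wordEquiv T (u ++ w), ?_, ?_, ?_⟩
  · simp only [hgdef, wordEquiv_append]
    group
  · refine le_trans ?_ (norm_le_pi_norm _ i₁)
    rw [displacement, norm_conj_wordEquiv_sub hT hc0, hprod, le_div_iff₀ hprodpos]
    have hz : dist (wordEquiv T (u ++ w) (b i₁)) (b i₀) ≤ τ * R := by
      rw [← hu, wordEquiv_append, AffineEquiv.coe_mul, comp_apply, dist_wordEquiv hT]
      exact mul_le_mul hu2 (hR (wordEquiv_mem hF w (hb i₁)) hy₀) dist_nonneg hτpos.le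
    have h1 := hlip g (b i₀) (wordEquiv T (u ++ w) (b i₁))
    have h2 : ‖g (b i₀) - b i₀‖ = D := hi₀
    have h3 := norm_sub_norm_le (g (b i₀) - b i₀)
      (g (wordEquiv T (u ++ w) (b i₁)) - wordEquiv T (u ++ w) (b i₁))
    rw [dist_comm] at hz
    have h4 : L * D * dist (b i₀) (wordEquiv T (u ++ w) (b i₁)) ≤ D / 2 := by
      calc _ ≤ L * D * (τ * R) := by gcongr
        _ = D * (τ * (L * R)) := by ring
        _ ≤ D * (1 / 2) := by gcongr; nlinarith
        _ = D / 2 := by ring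
    have h5 : m / (2 * B) * δ * ((u.map c).prod * cw) ≤ D / 2 := by
      calc _ ≤ m / (2 * B) * δ * (τ * cw) := by gcongr
        _ = (m * τ * (δ * cw)) / (2 * B) := by ring
        _ = D / 2 := by rw [hmτ]; field_simp
    linarith
  · refine (pi_norm_le_iff_of_nonneg hδ.le).2 fun i => ?_
    rw [displacement, norm_conj_wordEquiv_sub hT hc0, hprod, div_le_iff₀ hprodpos]
    have hzF : wordEquiv T (u ++ w) (b i) ∈ F := wordEquiv_mem hF _ (hb i)
    have h1 := hlip g (wordEquiv T (u ++ w) (b i)) (b i₀)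
    have h2 : ‖g (b i₀) - b i₀‖ = D := hi₀
    have h3 := norm_sub_norm_le
      (g (wordEquiv T (u ++ w) (b i)) - wordEquiv T (u ++ w) (b i)) (g (b i₀) - b i₀)
    have h4 : L * D * dist (wordEquiv T (u ++ w) (b i)) (b i₀) ≤ L * D * R :=
      mul_le_mul_of_nonneg_left (hR hzF (hb i₀)) (by positivity)
    have h5 : m * τ * (δ * cw) ≤ (u.map c).prod * (δ * cw) := by gcongr
    rw [hmτ, hB] at h5
    nlinarith

/-- Arbitrarily long lists of maps with displacement comparable to `δ` all of whose sublists
map the attractor into a common blow-up of itself. -/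
theorem exists_list_displacement_comparable [FiniteDimensional ℝ E] [Finite ι] [Nonempty ι]
    {T : ι → E ≃ᵃ[ℝ] E} {c : ι → ℝ} (hc : ∀ i, c i ∈ Ioo (0 : ℝ) 1)
    (hT : ∀ i x y, dist (T i x) (T i y) = c i * dist x y) {F : Set E}
    (hF : F = ⋃ i, T i '' F) (hFb : Bornology.IsBounded F) (b : AffineBasis κ ℝ E)
    (hb : ∀ i, b i ∈ F)
    (hsmall : ∀ ε > 0, ∃ p q : List ι, (wordEquiv T p)⁻¹ * wordEquiv T q ≠ 1 ∧
      ‖displacement b ((wordEquiv T p)⁻¹ * wordEquiv T q)‖ < ε) :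
    ∃ k : ℝ, 0 < k ∧ ∀ (δ : ℝ), 0 < δ → ∀ N : ℕ, ∃ (w : List ι) (l : List (E ≃ᵃ[ℝ] E)),
      l.length = N ∧
      (∀ h ∈ l, k * δ ≤ ‖displacement b h‖ ∧ ‖displacement b h‖ ≤ δ) ∧
      ∀ l' : List (E ≃ᵃ[ℝ] E), l'.Sublist l → ∀ x ∈ F, wordEquiv T w (l'.prod x) ∈ F := by
  obtain ⟨k, hk, hstep⟩ := exists_conj_displacement_comparable hc hT hF hFb b hb hsmall
  refine ⟨k, hk, fun δ hδ N => ?_⟩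
  suffices H : ∃ (w : List ι) (l : List (E ≃ᵃ[ℝ] E)), l.length = N ∧
      (∀ h ∈ l, k * δ ≤ ‖displacement b h‖ ∧ ‖displacement b h‖ ≤ δ) ∧
      ∀ l' : List (E ≃ᵃ[ℝ] E), l'.Sublist l → ∃ v : List ι, wordEquiv T w * l'.prod = wordEquiv T v by
    obtain ⟨w, l, h1, h2, h3⟩ := H
    refine ⟨w, l, h1, h2, fun l' hl' x hx => ?_⟩
    obtain ⟨v, hv⟩ := h3 l' hl'
    rw [← comp_apply (f := wordEquiv T w), ← AffineEquiv.coe_mul, hv]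
    exact wordEquiv_mem hF v hx
  induction N with
  | zero =>
    refine ⟨[], [], rfl, by simp, fun l' hl' => ⟨[], ?_⟩⟩
    rw [List.sublist_nil.1 hl']
    simp
  | succ N ih =>
    obtain ⟨w, l, hlen, hl, hsub⟩ := ih
    obtain ⟨p, q, h, hpq, hh⟩ := hstep w δ hδ
    refine ⟨p ++ w, h :: l, by simp [hlen], by simpa using ⟨hh, hl⟩, fun l' hl' => ?_⟩
    rcases List.sublist_cons_iff.1 hl' with h' | ⟨r, rfl, hr⟩
    · obtain ⟨v, hv⟩ := hsub l' h'
      exact ⟨p ++ v, by rw [wordEquiv_append, wordEquiv_append, mul_assoc, hv]⟩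
    · obtain ⟨v, hv⟩ := hsub r hr
      refine ⟨q ++ v, ?_⟩
      rw [List.prod_cons, wordEquiv_append, wordEquiv_append, ← mul_assoc, hpq, mul_assoc, hv]

end Zoom

section Chain

open scoped RealInnerProductSpace

variable {E : Type*} [NormedAddCommGroup E] [InnerProductSpace ℝ E]

/-- If every map in a list moves points near `x₀` by at least `σ` in the direction `e`, the partial
compositions applied to `x₀` form a `σ`-separated set. -/
theorem exists_separated_chain (l : List (E ≃ᵃ[ℝ] E)) {x₀ e : E} (he : ‖e‖ = 1) {σ θ δ : ℝ}
    (hσ : 0 < σ) (hδ : 0 ≤ δ)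
    (hl : ∀ h ∈ l, ∀ y, dist y x₀ ≤ θ → σ ≤ ⟪e, h y - y⟫ ∧ ‖h y - y‖ ≤ δ)
    (hlen : l.length * δ ≤ θ) :
    dist (l.prod x₀) x₀ ≤ l.length * δ ∧
    ∃ P : Finset E, P.card = l.length ∧
      (∀ p ∈ P, ∃ l' : List (E ≃ᵃ[ℝ] E), l'.Sublist l ∧ l'.prod x₀ = p) ∧
      (∀ p ∈ P, dist p x₀ ≤ θ) ∧ (∀ p ∈ P, ⟪e, p⟫ ≤ ⟪e, l.prod x₀⟫) ∧
      ∀ p ∈ P, ∀ q ∈ P, p ≠ q → σ ≤ dist p q := by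
  classical
  induction l with
  | nil => exact ⟨by simp, ∅, by simp⟩
  | cons h l ih =>
    simp only [List.length_cons, Nat.cast_add, Nat.cast_one] at hlen ⊢
    have hlen' : l.length * δ ≤ θ := by linarith
    obtain ⟨hdist, P, hcard, hsub, hPθ, htop, hsep⟩ :=
      ih (fun g hg => hl g (List.mem_cons_of_mem _ hg)) hlen'
    obtain ⟨hmove, hnorm⟩ := hl h List.mem_cons_self (l.prod x₀) (hdist.trans hlen')
    set z : E := (h :: l).prod x₀ with hz
    have hzh : h (l.prod x₀) = z := by simp [hz]
    rw [hzh] at hmove hnorm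
    rw [inner_sub_right] at hmove
    have hzdist : dist z x₀ ≤ (l.length + 1) * δ := by
      have := dist_triangle z (l.prod x₀) x₀
      rw [dist_eq_norm z (l.prod x₀)] at this
      linarith
    have hgap : ∀ p ∈ P, σ ≤ ⟪e, z⟫ - ⟪e, p⟫ := fun p hp => by linarith [htop p hp]
    have hfar : ∀ p ∈ P, σ ≤ dist z p := fun p hp => by
      have := real_inner_le_norm e (z - p)
      rw [inner_sub_right, he, one_mul, ← dist_eq_norm] at this
      exact (hgap p hp).trans this
    refine ⟨hzdist, insert z P, ?_, ?_, ?_, ?_, ?_⟩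
    · rw [Finset.card_insert_of_notMem, hcard]
      intro hzP
      have := hfar z hzP
      rw [dist_self] at this
      linarith
    · simp only [Finset.forall_mem_insert]
      refine ⟨⟨h :: l, List.Sublist.refl _, rfl⟩, fun p hp => ?_⟩
      obtain ⟨l', hl', hl'p⟩ := hsub p hp
      exact ⟨l', hl'.cons h, hl'p⟩
    · simp only [Finset.forall_mem_insert]
      exact ⟨hzdist.trans hlen, hPθ⟩
    · simp only [Finset.forall_mem_insert]
      exact ⟨le_rfl, fun p hp => by linarith [hgap p hp]⟩
    · simp only [Finset.forall_mem_insert]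
      refine ⟨⟨fun hne => absurd rfl hne, fun p hp _ => hfar p hp⟩, fun p hp =>
        ⟨fun _ => ?_, fun q hq => hsep p hp q hq⟩⟩
      rw [dist_comm]
      exact hfar p hp

end Chain

theorem List.length_le_sum_length_filter {α β : Type*} [DecidableEq β] (f : α → β) (s : Finset β)
    (l : List α) (hl : ∀ a ∈ l, f a ∈ s) :
    l.length ≤ ∑ t ∈ s, (l.filter fun a => f a = t).length := by
  have h := Multiset.sum_count_eq_card (s := s) (m := (l.map f : Multiset β)) (by simpa using hl)
  rw [Multiset.coe_card, List.length_map] at h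
  rw [← h]
  refine Finset.sum_le_sum fun t _ => ?_
  rw [Multiset.coe_count, List.count, List.countP_map, List.countP_eq_length_filter]
  exact le_of_eq (by congr 1)

theorem card_le_card_of_separated_cover {X : Type*} [MetricSpace X] {P t : Finset X} {ρ : ℝ}
    (hcover : ↑P ⊆ ⋃ y ∈ t, ball y ρ) (hsep : ∀ p ∈ P, ∀ q ∈ P, p ≠ q → 2 * ρ ≤ dist p q) :
    P.card ≤ t.card := by
  have h : ∀ p ∈ P, ∃ y ∈ t, p ∈ ball y ρ := fun p hp => by simpa using hcover hp
  choose! f hf hfb using h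
  refine Finset.card_le_card_of_injOn f hf fun p hp q hq hpq => ?_
  by_contra hne
  have h1 := mem_ball.1 (hfb p hp)
  have h2 := mem_ball.1 (hfb q hq)
  rw [← hpq] at h2
  linarith [hsep p hp q hq hne, dist_triangle_right p q (f p)]

section Main

open scoped RealInnerProductSpace Topology

variable {ι κ E : Type*} [Fintype κ] [NormedAddCommGroup E] [InnerProductSpace ℝ E]

/-- The displacement of points near a suitable basis point is governed by the normalised
displacement vector. -/
theorem displacement_direction (b : AffineBasis κ ℝ E) {L : ℝ} (hL : 0 ≤ L)
    {h : E ≃ᵃ[ℝ] E}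
    (hlip : ∀ y z : E, ‖(h y - y) - (h z - z)‖ ≤ L * ‖displacement b h‖ * dist y z)
    {t : κ → E} {i : κ} (hi : ‖t i‖ = 1)
    (ht : ‖displacement b h - ‖displacement b h‖ • t‖ ≤ ‖displacement b h‖ / 4)
    {θ : ℝ} (hθ : L * θ ≤ 1 / 4) {y : E} (hy : dist y (b i) ≤ θ) :
    ‖displacement b h‖ / 2 ≤ ⟪t i, h y - y⟫ ∧ ‖h y - y‖ ≤ 3 / 2 * ‖displacement b h‖ := by
  set D := ‖displacement b h‖ with hD
  have hD0 : 0 ≤ D := norm_nonneg _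
  have h1 : ‖(h y - y) - (h (b i) - b i)‖ ≤ D / 4 :=
    calc _ ≤ L * D * dist y (b i) := hlip y (b i)
      _ ≤ L * D * θ := by gcongr
      _ = D * (L * θ) := by ring
      _ ≤ D * (1 / 4) := by gcongr
      _ = D / 4 := by ring
  have h2 : ‖(h (b i) - b i) - D • t i‖ ≤ D / 4 := (norm_le_pi_norm _ i).trans ht
  have h3 : ‖(h y - y) - D • t i‖ ≤ D / 2 :=
    (norm_sub_le_norm_sub_add_norm_sub _ (h (b i) - b i) _).trans (by linarith)
  constructor
  · have h4 := (abs_le.1 (abs_real_inner_le_norm (t i) ((h y - y) - D • t i))).1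
    rw [inner_sub_right, inner_smul_right, real_inner_self_eq_norm_sq, hi] at h4
    linarith
  · have h4 := norm_sub_norm_le (h y - y) (D • t i)
    rw [norm_smul, hi, Real.norm_of_nonneg hD0] at h4
    linarith

theorem one_le_covering_exponent [FiniteDimensional ℝ E] [Finite ι] [Nonempty ι]
    {T : ι → E ≃ᵃ[ℝ] E} {c : ι → ℝ} (hc : ∀ i, c i ∈ Ioo (0 : ℝ) 1)
    (hT : ∀ i x y, dist (T i x) (T i y) = c i * dist x y) {F : Set E}
    (hF : F = ⋃ i, T i '' F) (hFb : Bornology.IsBounded F) (b : AffineBasis κ ℝ E)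
    (hb : ∀ i, b i ∈ F)
    (hsmall : ∀ ε > 0, ∃ p q : List ι, (wordEquiv T p)⁻¹ * wordEquiv T q ≠ 1 ∧
      ‖displacement b ((wordEquiv T p)⁻¹ * wordEquiv T q)‖ < ε)
    {s K : ℝ}
    (hcover : ∀ r ρ : ℝ, 0 < ρ → ρ < r → r ≤ 1 →
      ∀ x ∈ F, ∃ t : Finset E, (F ∩ ball x r ⊆ ⋃ y ∈ t, ball y ρ) ∧
        (t.card : ℝ) ≤ K * (r / ρ) ^ s) : 1 ≤ s := by
  classical
  obtain ⟨k, hk, hlist⟩ := exists_list_displacement_comparable hc hT hF hFb b hb hsmall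
  obtain ⟨L, hL, hlip⟩ := exists_lipschitz_displacement b
  have hc0 : ∀ i, 0 < c i := fun i => (hc i).1
  have : ProperSpace (κ → E) := FiniteDimensional.proper ℝ _
  obtain ⟨V, hVsub, hVfin, hV⟩ := (isCompact_sphere (0 : κ → E) 1).finite_cover_balls
    (e := 1 / 4) (by norm_num)
  lift V to Finset (κ → E) using hVfin
  have hdir : ∀ h : E ≃ᵃ[ℝ] E, 0 < ‖displacement b h‖ → ∃ t ∈ V,
      ‖displacement b h - ‖displacement b h‖ • t‖ ≤ ‖displacement b h‖ / 4 := by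
    intro h hh
    have hmem : ‖displacement b h‖⁻¹ • displacement b h ∈ sphere (0 : κ → E) 1 := by
      rw [mem_sphere_zero_iff_norm, norm_smul, norm_inv, norm_norm, inv_mul_cancel₀ hh.ne']
    obtain ⟨t, ht, htb⟩ := mem_iUnion₂.1 (hV hmem)
    refine ⟨t, ht, ?_⟩
    rw [mem_ball, dist_eq_norm] at htb
    have hdecomp : displacement b h - ‖displacement b h‖ • t =
        ‖displacement b h‖ • (‖displacement b h‖⁻¹ • displacement b h - t) := by
      rw [smul_sub, smul_inv_smul₀ hh.ne']
    rw [hdecomp, norm_smul, norm_norm]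
    nlinarith
  choose! f hfV hf using hdir
  set θ : ℝ := 1 / (4 * (L + 1)) with hθ
  have hθpos : 0 < θ := by positivity
  have hLθ : L * θ ≤ 1 / 4 := by
    rw [hθ, mul_one_div, div_le_iff₀ (by positivity)]
    linarith
  have hθ1 : θ ≤ 1 := by
    rw [hθ, div_le_one (by positivity)]
    linarith
  have hbound : ∀ N : ℕ, k < N → (N : ℝ) ≤ V.card * (K * (12 * N / k) ^ s) := by
    intro N hN
    have hN0 : (0 : ℝ) < N := hk.trans hN
    set δ : ℝ := θ / (3 * N) with hδ
    have hδpos : 0 < δ := by positivity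
    obtain ⟨w, l, hlen, hl, hsub⟩ := hlist δ hδpos N
    have hlpos : ∀ h ∈ l, 0 < ‖displacement b h‖ := fun h hh =>
      (mul_pos hk hδpos).trans_le (hl h hh).1
    have hpigeon := List.length_le_sum_length_filter f V l fun h hh => hfV h (hlpos h hh)
    rw [hlen] at hpigeon
    have hclass : ∀ t ∈ V, ((l.filter fun h => f h = t).length : ℝ) ≤ K * (12 * N / k) ^ s := by
      intro t ht
      obtain ⟨i, hi⟩ := exists_norm_displacement_eq b t
      rw [mem_sphere_zero_iff_norm.1 (hVsub ht)] at hi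
      set l₁ := l.filter fun h => f h = t with hl₁
      have hl₁sub : l₁.Sublist l := List.filter_sublist
      have hlen₁ : (l₁.length : ℝ) ≤ N := by
        rw [← hlen]; exact_mod_cast hl₁sub.length_le
      set σ : ℝ := k * δ / 2 with hσ
      have hσpos : 0 < σ := by positivity
      obtain ⟨-, P, hPcard, hPsub, hPθ, -, hPsep⟩ := exists_separated_chain l₁ (x₀ := b i) hi
        (σ := σ) (θ := θ / 2) (δ := 3 / 2 * δ) hσpos (by positivity)
        (fun h hh y hy => by
          rw [hl₁, List.mem_filter, decide_eq_true_iff] at hh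
          obtain ⟨hhl, rfl⟩ := hh
          obtain ⟨h1, h2⟩ := displacement_direction b hL (hlip h) hi (hf h (hlpos h hhl)) hLθ
            (hy.trans (by linarith))
          obtain ⟨h3, h4⟩ := hl h hhl
          constructor <;> linarith)
        (calc l₁.length * (3 / 2 * δ) ≤ N * (3 / 2 * δ) := by gcongr
          _ = θ / 2 := by rw [hδ]; field_simp)
      set C : ℝ := (w.map c).prod with hC
      have hCpos : 0 < C := wordRatio_pos hc0 w
      have hC1 : C ≤ 1 := wordRatio_le_one hc w
      have hρr : C * (σ / 2) < C * θ := by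
        refine mul_lt_mul_of_pos_left ?_ hCpos
        rw [hσ, hδ, div_div, ← mul_div_assoc, div_div, div_lt_iff₀ (by positivity)]
        nlinarith
      obtain ⟨u, hu, hucard⟩ := hcover (C * θ) (C * (σ / 2)) (by positivity) hρr
        (mul_le_one₀ hC1 hθpos.le hθ1) _ (wordEquiv_mem hF w (hb i))
      have hratio : C * θ / (C * (σ / 2)) = 12 * N / k := by
        rw [hσ, hδ]
        field_simp
        norm_num
      rw [hratio] at hucard
      refine le_trans ?_ hucard
      rw [← hPcard, ← Finset.card_image_of_injective P (wordEquiv T w).injective]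
      refine Nat.cast_le.2 (card_le_card_of_separated_cover (ρ := C * (σ / 2)) ?_ ?_)
      · refine Subset.trans (fun z hz => ?_) hu
        obtain ⟨p, hp, rfl⟩ := Finset.mem_image.1 (Finset.mem_coe.1 hz)
        refine ⟨?_, ?_⟩
        · obtain ⟨l', hl', rfl⟩ := hPsub p hp
          exact hsub l' (hl'.trans hl₁sub) _ (hb i)
        · rw [mem_ball, dist_wordEquiv hT]
          exact mul_lt_mul_of_pos_left (by linarith [hPθ p hp]) hCpos
      · simp only [Finset.forall_mem_image]
        intro p hp q hq hpq
        rw [dist_wordEquiv hT]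
        have := hPsep p hp q hq fun h => hpq (by rw [h])
        calc 2 * (C * (σ / 2)) = C * σ := by ring
          _ ≤ C * dist p q := by gcongr
    calc (N : ℝ) ≤ ∑ t ∈ V, ((l.filter fun h => f h = t).length : ℝ) := by exact_mod_cast hpigeon
      _ ≤ V.card • (K * (12 * N / k) ^ s) := Finset.sum_le_card_nsmul _ _ _ hclass
      _ = V.card * (K * (12 * N / k) ^ s) := nsmul_eq_mul _ _
  by_contra! hs
  have htend : Tendsto (fun N : ℕ => (N : ℝ) ^ (1 - s)) atTop atTop :=
    (tendsto_rpow_atTop (by linarith)).comp tendsto_natCast_atTop_atTop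
  obtain ⟨N, hN, hkN⟩ := ((htend.eventually_gt_atTop (V.card * (K * (12 / k) ^ s))).and
    (tendsto_natCast_atTop_atTop.eventually_gt_atTop k)).exists
  have hN0 : (0 : ℝ) < N := hk.trans hkN
  have h := hbound N hkN
  rw [mul_div_right_comm, Real.mul_rpow (by positivity) hN0.le] at h
  rw [Real.rpow_sub hN0, Real.rpow_one, lt_div_iff₀ (by positivity)] at hN
  linarith

end Main

theorem exists_small_displacement_of_not_wsp {ι κ E : Type*} [Fintype κ] [NormedAddCommGroup E]
    [NormedSpace ℝ E] {S : ι → E → E} {T : ι → E ≃ᵃ[ℝ] E} (hTS : ∀ i, ⇑(T i) = S i)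
    (b : AffineBasis κ ℝ E) (hWSP : ¬ SatisfiesWSP S) {ε : ℝ} (hε : 0 < ε) :
    ∃ p q : List ι, (wordEquiv T p)⁻¹ * wordEquiv T q ≠ 1 ∧
      ‖displacement b ((wordEquiv T p)⁻¹ * wordEquiv T q)‖ < ε := by
  have hcl := not_not.1 hWSP
  have hopen : IsOpen {g : E → E | ∀ i, dist (g (b i)) (b i) < ε} := by
    simp only [ofPred_forall]
    exact isOpen_iInter_of_finite fun i =>
      isOpen_lt ((continuous_apply (b i)).dist continuous_const) continuous_const
  obtain ⟨g, hg, ⟨p, q, -, -, -, rfl⟩, hgid⟩ :=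
    mem_closure_iff.1 hcl _ hopen (fun i => by simpa using hε)
  have hgeq : invFun (wordMap S p) ∘ wordMap S q = ⇑((wordEquiv T p)⁻¹ * wordEquiv T q) := by
    rw [AffineEquiv.coe_mul, coe_wordEquiv hTS q, ← coe_wordEquiv hTS p]
    congr 1
    refine (leftInverse_invFun (wordEquiv T p).injective).eq_rightInverse fun x => ?_
    simp [AffineEquiv.inv_def]
  rw [hgeq] at hg hgid
  refine ⟨p, q, fun h => hgid (by rw [h]; rfl), (pi_norm_lt_iff hε).2 fun i => ?_⟩
  rw [displacement, ← dist_eq_norm]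
  exact hg i

/-- **Failure of WSP in `ℝ^d` forces Assouad dimension at least one.**  Let `F` be a
self-similar set in `ℝ^d`, attractor of an IFS of contracting similarities, not
contained in any `(d-1)`-dimensional hyperplane.  If the IFS does not satisfy the weak
separation property, then `dim_A F ≥ 1`. -/
theorem assouad_ge_one_of_not_wsp_Rd {d : ℕ} {ι : Type} [Fintype ι] [Nonempty ι]
    (S : ι → EuclideanSpace ℝ (Fin d) → EuclideanSpace ℝ (Fin d)) (c : ι → ℝ)
    (hc : ∀ i, c i ∈ Set.Ioo (0 : ℝ) 1)
    (hsim : ∀ i x y, dist (S i x) (S i y) = c i * dist x y)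
    (F : Set (EuclideanSpace ℝ (Fin d))) (hFcomp : IsCompact F) (hFne : F.Nonempty)
    (hFattr : F = ⋃ i, S i '' F)
    (hFspan : affineSpan ℝ F = ⊤)
    (hWSP : ¬ SatisfiesWSP S) :
    1 ≤ assouadDim F := by
  choose T hTS using fun i => exists_affineEquiv_of_similarity (hc i).1 (hsim i)
  obtain ⟨B, hBF, b, hb⟩ := AffineBasis.exists_affine_subbasis hFspan
  have : Fintype B := @Fintype.ofFinite _ b.finite_set
  obtain ⟨s, hs⟩ := exists_covering_exponent F
  refine le_csInf ⟨s, hs⟩ ?_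
  rintro s ⟨-, K, -, hcover⟩
  refine one_le_covering_exponent (T := T) hc (by simpa [hTS] using hsim) (by simpa [hTS])
    hFcomp.isBounded b (fun i => ?_)
    (fun ε hε => exists_small_displacement_of_not_wsp hTS b hWSP hε) hcover
  rw [hb]
  exact hBF i.2
end

section
/- Let t = 4·∑_{k=0}^∞ 5^{−2^k} and let F ⊆ [0,1]^2 be the attractor of the IFS on [0,1]^2 consisting of the four maps S_1(x) = x/5, S_2(x) = x/5 + (t/5, 0), S_3(x) = x/5 + (4/5, 0), S_4(x) = x/5 + (0, 4/5). Then F is not contained in any line, and dim_H F ≤ log 4 / log 5 < 1 ≤ dim_A F ≤ 1 + log 2 / log 5 < 2; in particular the Assouad dimension of F is strictly between its Hausdorff dimension and the ambient dimension 2. -/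
open Set Metric Filter Function MeasureTheory

open scoped Topology

/-- If `F` is closed under the maps `x ↦ x/5 + a/5 • e`, then the `n`-fold compositions of such maps
are the maps `x ↦ 5⁻ⁿ (x + v • e)` with `v` in this set. -/
def shiftSet {V : Type*} [AddCommGroup V] [Module ℝ V] (F : Set V) (e : V) (n : ℕ) : Set ℝ :=
  {v | ∀ x ∈ F, ((5 : ℝ)⁻¹) ^ n • (x + v • e) ∈ F}

section Shift

variable {V : Type*} [AddCommGroup V] [Module ℝ V] {F : Set V} {e : V}

theorem shiftSet_add {n m : ℕ} {v w : ℝ} (hv : v ∈ shiftSet F e n) (hw : w ∈ shiftSet F e m) :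
    5 ^ m * v + w ∈ shiftSet F e (n + m) := by
  intro x hx
  have h := hv _ (hw x hx)
  have h5 : ((5 : ℝ)⁻¹) ^ m * 5 ^ m = 1 := by rw [← mul_pow]; norm_num
  convert h using 1
  rw [pow_add, mul_smul]
  congr 1
  rw [smul_add, smul_add, add_smul, smul_add, mul_smul, smul_smul _ (5 ^ m : ℝ), h5, one_smul]
  abel

theorem zero_mem_shiftSet (h0 : (0 : ℝ) ∈ shiftSet F e 1) (n : ℕ) : (0 : ℝ) ∈ shiftSet F e n := by
  induction n with
  | zero => intro x hx; simpa using hx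
  | succ n ih => simpa using shiftSet_add ih h0

theorem shiftSet_mono (h0 : (0 : ℝ) ∈ shiftSet F e 1) {n m : ℕ} (hnm : n ≤ m) {v : ℝ}
    (hv : v ∈ shiftSet F e n) : v ∈ shiftSet F e m := by
  have h := shiftSet_add (zero_mem_shiftSet h0 (m - n)) hv
  rw [Nat.sub_add_cancel hnm] at h
  simpa using h

theorem pow_mul_mem_shiftSet (h0 : (0 : ℝ) ∈ shiftSet F e 1) {n : ℕ} (k : ℕ) {v : ℝ}
    (hv : v ∈ shiftSet F e n) : 5 ^ k * v ∈ shiftSet F e (n + k) := by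
  simpa using shiftSet_add hv (zero_mem_shiftSet h0 k)

theorem pow_mul_partialSum_mem_shiftSet (h0 : (0 : ℝ) ∈ shiftSet F e 1)
    (h4 : (4 : ℝ) ∈ shiftSet F e 1) (k : ℕ) :
    5 ^ (2 ^ k) * (4 * ∑ j ∈ Finset.range (k + 1), ((5 : ℝ)⁻¹) ^ (2 ^ j)) ∈
      shiftSet F e (2 ^ k) := by
  induction k with
  | zero => norm_num; exact h4
  | succ k ih =>
    have h := shiftSet_add ih (shiftSet_mono h0 (Nat.one_le_two_pow (n := k)) h4)
    rw [← two_mul, ← pow_succ'] at h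
    convert h using 1
    have h5 : ((5 : ℝ)⁻¹) ^ (2 ^ (k + 1)) * 5 ^ (2 ^ (k + 1)) = 1 := by
      rw [← mul_pow]; norm_num
    have h6 : (5 : ℝ) ^ (2 ^ (k + 1)) = 5 ^ (2 ^ k) * 5 ^ (2 ^ k) := by
      rw [← pow_add, ← two_mul, ← pow_succ']
    rw [Finset.sum_range_succ, mul_add, mul_add, ← mul_assoc _ _ (_ ^ (2 ^ (k + 1))),
      mul_right_comm, mul_comm (5 ^ (2 ^ (k + 1))) (_ ^ (2 ^ (k + 1))), h5, h6]
    ring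

end Shift

theorem two_pow_le_two_pow_add (k i : ℕ) : 2 ^ (k + 1) + i ≤ 2 ^ (i + (k + 1)) := by
  have h1 : i + 1 ≤ 2 ^ i := Nat.lt_two_pow_self
  have h2 : 1 ≤ 2 ^ (k + 1) := Nat.one_le_two_pow
  rw [pow_add 2 i]
  nlinarith

theorem summable_inv_five_pow_two_pow : Summable fun k : ℕ => ((5 : ℝ)⁻¹) ^ (2 ^ k) := by
  refine Summable.of_nonneg_of_le (fun k => by positivity) (fun k => ?_)
    (summable_geometric_of_lt_one (r := (5 : ℝ)⁻¹) (by norm_num) (by norm_num))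
  exact pow_le_pow_of_le_one (by norm_num) (by norm_num) Nat.lt_two_pow_self.le

theorem tsum_sub_partialSum_bounds (k : ℕ) :
    0 < 4 * ∑' k : ℕ, ((5 : ℝ)⁻¹) ^ (2 ^ k)
        - 4 * ∑ j ∈ Finset.range (k + 1), ((5 : ℝ)⁻¹) ^ (2 ^ j) ∧
      4 * ∑' k : ℕ, ((5 : ℝ)⁻¹) ^ (2 ^ k)
        - 4 * ∑ j ∈ Finset.range (k + 1), ((5 : ℝ)⁻¹) ^ (2 ^ j) ≤
        5 * ((5 : ℝ)⁻¹) ^ (2 ^ (k + 1)) := by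
  have hs := summable_inv_five_pow_two_pow
  have hs' := (summable_nat_add_iff (k + 1)).2 hs
  have h := hs.sum_add_tsum_nat_add (k + 1)
  have hpos : 0 < ∑' i : ℕ, ((5 : ℝ)⁻¹) ^ (2 ^ (i + (k + 1))) :=
    hs'.tsum_pos (fun i => by positivity) 0 (by positivity)
  have hg := summable_geometric_of_lt_one (r := (5 : ℝ)⁻¹) (by norm_num) (by norm_num)
  have hle : ∑' i : ℕ, ((5 : ℝ)⁻¹) ^ (2 ^ (i + (k + 1))) ≤
      ∑' i : ℕ, ((5 : ℝ)⁻¹) ^ (2 ^ (k + 1)) * ((5 : ℝ)⁻¹) ^ i := by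
    refine hs'.tsum_le_tsum (fun i => ?_) (hg.mul_left _)
    rw [← pow_add]
    exact pow_le_pow_of_le_one (by norm_num) (by norm_num) (two_pow_le_two_pow_add k i)
  rw [tsum_mul_left, tsum_geometric_of_lt_one (by norm_num) (by norm_num)] at hle
  constructor
  · linarith
  · norm_num at hle ⊢
    linarith

section Chain

variable {V : Type*} [AddCommGroup V] [Module ℝ V] {F : Set V} {e : V} {t : ℝ}

/-- The shifts of a common level come arbitrarily close to each other without coinciding. -/
theorem exists_close_shifts (ht : t = 4 * ∑' k : ℕ, ((5 : ℝ)⁻¹) ^ (2 ^ k))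
    (h0 : (0 : ℝ) ∈ shiftSet F e 1) (h4 : (4 : ℝ) ∈ shiftSet F e 1)
    (h_t : t ∈ shiftSet F e 1) {δ : ℝ} (hδ : 0 < δ) :
    ∃ n a b, a ∈ shiftSet F e n ∧ b ∈ shiftSet F e n ∧ a < b ∧ b - a < δ := by
  obtain ⟨k, hk⟩ := exists_pow_lt_of_lt_one (show 0 < δ / 5 by positivity)
    (show (5 : ℝ)⁻¹ < 1 by norm_num)
  have ha := shiftSet_mono h0 (Nat.le_add_left _ 1) (pow_mul_partialSum_mem_shiftSet h0 h4 k)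
  refine ⟨1 + 2 ^ k, _, _, ha, pow_mul_mem_shiftSet h0 (2 ^ k) h_t, ?_⟩
  obtain ⟨h1, h2⟩ := tsum_sub_partialSum_bounds k
  rw [← ht] at h1 h2
  have hp : (0 : ℝ) < 5 ^ (2 ^ k) := by positivity
  have h5 : (5 : ℝ) ^ (2 ^ k) * ((5 : ℝ)⁻¹) ^ (2 ^ (k + 1)) = ((5 : ℝ)⁻¹) ^ (2 ^ k) := by
    rw [pow_succ, mul_two, pow_add, ← mul_assoc, ← mul_pow]; norm_num
  have h6 : ((5 : ℝ)⁻¹) ^ (2 ^ k) ≤ ((5 : ℝ)⁻¹) ^ k :=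
    pow_le_pow_of_le_one (by norm_num) (by norm_num) Nat.lt_two_pow_self.le
  constructor
  · exact mul_lt_mul_of_pos_left (by linarith) hp
  · rw [← mul_sub]
    have := mul_le_mul_of_nonneg_left h2 hp.le
    linarith

/-- The shifts of a common level contain arbitrarily long chains with prescribed small gaps. -/
theorem exists_shift_chain (h0 : (0 : ℝ) ∈ shiftSet F e 1)
    (hclose : ∀ δ : ℝ, 0 < δ →
      ∃ n a b, a ∈ shiftSet F e n ∧ b ∈ shiftSet F e n ∧ a < b ∧ b - a < δ)
    {η : ℝ} (hη : 0 < η) (N : ℕ) :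
    ∃ (n : ℕ) (q : ℕ → ℝ), (∀ j ≤ N, q j ∈ shiftSet F e n) ∧
      ∀ i j, i ≤ j → j ≤ N → η * ((j : ℝ) - i) ≤ q j - q i ∧ q j - q i ≤ 5 * η * ((j : ℝ) - i) := by
  induction N with
  | zero =>
    refine ⟨1, fun _ => 0, fun _ _ => h0, fun i j hij hj => ?_⟩
    obtain rfl : j = 0 := by omega
    obtain rfl : i = 0 := by omega
    simp
  | succ N ih =>
    obtain ⟨m, q, hq, hd⟩ := ih
    obtain ⟨n, a, b, ha, hb, hab, hlt⟩ := hclose (η / 5 ^ m) (by positivity)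
    have hpos : 0 < 5 ^ m * (b - a) := mul_pos (by positivity) (sub_pos.2 hab)
    have hlt' : 5 ^ m * (b - a) < η := by
      rw [lt_div_iff₀ (by positivity)] at hlt; linarith
    obtain ⟨k, hk1, hk2⟩ := exists_nat_pow_near (x := η / (5 ^ m * (b - a))) (y := 5)
      (by rw [one_le_div hpos]; exact hlt'.le) (by norm_num)
    rw [le_div_iff₀ hpos] at hk1
    rw [div_lt_iff₀ hpos, pow_succ] at hk2
    have ha' := pow_mul_mem_shiftSet h0 (k + 1) ha
    have hb' := pow_mul_mem_shiftSet h0 (k + 1) hb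
    refine ⟨n + (k + 1) + m, fun j => if j ≤ N then 5 ^ m * (5 ^ (k + 1) * a) + q j
      else 5 ^ m * (5 ^ (k + 1) * b) + q N, fun j hj => ?_, fun i j hij hj => ?_⟩
    · dsimp only
      split_ifs with h
      · exact shiftSet_add ha' (hq j h)
      · exact shiftSet_add hb' (hq N le_rfl)
    · rcases Nat.lt_or_ge N j with h | h
      · obtain rfl : j = N + 1 := by omega
        rcases Nat.lt_or_ge N i with h' | h'
        · obtain rfl : i = N + 1 := by omega
          simp
        · have := hd i N h' le_rfl
          simp only [if_pos h', if_neg (Nat.not_le.2 h)]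
          push_cast
          rw [pow_succ]
          constructor <;> nlinarith
      · have := hd i j hij h
        simp only [if_pos h, if_pos (hij.trans h)]
        constructor <;> linarith

end Chain

/-- A set containing arbitrarily long, suitably small, well-spaced chains along a line has
Assouad exponents at least one. -/
theorem one_le_of_shift_chain {V : Type*} [NormedAddCommGroup V] [NormedSpace ℝ V] {F : Set V}
    {e : V} (he : ‖e‖ = 1) (hF : F.Nonempty)
    (hchain : ∀ η : ℝ, 0 < η → ∀ N : ℕ, ∃ (n : ℕ) (q : ℕ → ℝ), (∀ j ≤ N, q j ∈ shiftSet F e n) ∧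
      ∀ i j, i ≤ j → j ≤ N → η * ((j : ℝ) - i) ≤ q j - q i ∧ q j - q i ≤ 5 * η * ((j : ℝ) - i))
    {s K : ℝ} (hcov : ∀ r ρ : ℝ, 0 < ρ → ρ < r → r ≤ 1 →
      ∀ x ∈ F, ∃ T : Finset V, (F ∩ Metric.ball x r ⊆ ⋃ y ∈ T, Metric.ball y ρ) ∧
      (T.card : ℝ) ≤ K * (r / ρ) ^ s) : 1 ≤ s := by
  by_contra! hs
  obtain ⟨x0, hx0⟩ := hF
  have hlim := (tendsto_rpow_atTop (sub_pos.2 hs)).comp (tendsto_natCast_atTop_atTop (R := ℝ))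
  obtain ⟨N, hN1, hN⟩ := ((hlim.eventually_gt_atTop (K * 20 ^ s)).and
    (eventually_ge_atTop 1)).exists
  simp only [Function.comp_apply] at hN1
  have hN0 : (0 : ℝ) < N := by exact_mod_cast hN
  have hN' : (1 : ℝ) ≤ N := by exact_mod_cast hN
  obtain ⟨n, q, hq, hd⟩ := hchain (1 / (10 * N)) (by positivity) N
  set η : ℝ := 1 / (10 * N) with hη
  have hη0 : 0 < η := by positivity
  have hηN : η * N = 1 / 10 := by rw [hη]; field_simp
  have hη1 : η ≤ 1 / 10 := by nlinarith
  set c : ℝ := ((5 : ℝ)⁻¹) ^ n with hc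
  have hc0 : 0 < c := by positivity
  have hc1 : c ≤ 1 := pow_le_one₀ (by norm_num) (by norm_num)
  set p : ℕ → V := fun j => c • (x0 + q j • e) with hp
  have hpF : ∀ j ≤ N, p j ∈ F := fun j hj => hq j hj x0 hx0
  have hdist : ∀ i j, dist (p i) (p j) = c * |q i - q j| := by
    intro i j
    rw [hp, dist_eq_norm]
    dsimp only
    rw [← smul_sub, add_sub_add_left_eq_sub, ← sub_smul, norm_smul, norm_smul, he, mul_one,
      Real.norm_eq_abs, Real.norm_eq_abs, abs_of_pos hc0]
  have hsep : ∀ i j, i < j → j ≤ N → c * η ≤ dist (p i) (p j) := by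
    intro i j hij hj
    rw [hdist, abs_sub_comm]
    have h1 := (hd i j hij.le hj).1
    have h2 : (i : ℝ) + 1 ≤ j := by exact_mod_cast hij
    have h3 : η ≤ q j - q i := by nlinarith
    exact mul_le_mul_of_nonneg_left (h3.trans (le_abs_self _)) hc0.le
  obtain ⟨T, hT, hcard⟩ := hcov c (c * η / 2) (by positivity) (by nlinarith) hc1 (p 0)
    (hpF 0 (Nat.zero_le _))
  have hmem : ∀ j ∈ Finset.range (N + 1), ∃ y ∈ T, dist (p j) y < c * η / 2 := by
    intro j hj
    have hj : j ≤ N := Nat.lt_succ_iff.1 (Finset.mem_range.1 hj)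
    have hb : p j ∈ Metric.ball (p 0) c := by
      rw [Metric.mem_ball, hdist]
      obtain ⟨h1, h2⟩ := hd 0 j (Nat.zero_le _) hj
      have hjN : (j : ℝ) ≤ N := by exact_mod_cast hj
      have hj0 : (0 : ℝ) ≤ j := Nat.cast_nonneg j
      push_cast at h1 h2
      have h3 : q j - q 0 ≤ 1 / 2 := by nlinarith
      rw [abs_of_nonneg (by nlinarith)]
      nlinarith
    simpa using hT ⟨hpF j hj, hb⟩
  choose! g hgT hg using hmem
  have hinj : Set.InjOn g (Finset.range (N + 1) : Set ℕ) := by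
    intro i hi j hj hij
    by_contra hne
    have key : ∀ i j, i < j → i ∈ Finset.range (N + 1) → j ∈ Finset.range (N + 1) →
        g i ≠ g j := by
      intro i j h hi hj hij
      have h1 := hsep i j h (Nat.lt_succ_iff.1 (Finset.mem_range.1 hj))
      have h2 := hg i hi
      have h3 := hg j hj
      rw [hij] at h2
      have := dist_triangle_right (p i) (p j) (g j)
      linarith
    rcases Nat.lt_or_gt_of_ne hne with h | h
    · exact key i j h hi hj hij
    · exact key j i h hj hi hij.symm
  have hle := Finset.card_le_card_of_injOn g hgT hinj
  rw [Finset.card_range] at hle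
  have hle' : (N : ℝ) + 1 ≤ T.card := by exact_mod_cast hle
  have hratio : c / (c * η / 2) = 20 * N := by rw [hη]; field_simp; norm_num
  rw [hratio, Real.mul_rpow (by norm_num) hN0.le] at hcard
  have hNs : (N : ℝ) ^ (1 - s) * (N : ℝ) ^ s = N := by
    rw [← Real.rpow_add hN0]; simp
  have : 0 < (N : ℝ) ^ s := Real.rpow_pos_of_pos hN0 s
  nlinarith

section Cantor

variable {P : Set ℝ}

theorem exists_cover_of_subset_Icc (h01 : P ⊆ Icc 0 1)
    (hP : ∀ y ∈ P, ∃ z ∈ P, y = z / 5 ∨ y = z / 5 + 4 / 5) (m : ℕ) :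
    ∃ T : Finset ℝ, T.card ≤ 2 ^ m ∧ ∀ y ∈ P, ∃ c ∈ T, |y - c| ≤ ((5 : ℝ)⁻¹) ^ m := by
  induction m with
  | zero =>
    refine ⟨{0}, by simp, fun y hy => ⟨0, by simp, ?_⟩⟩
    rw [sub_zero, pow_zero, abs_of_nonneg (h01 hy).1]
    exact (h01 hy).2
  | succ m ih =>
    obtain ⟨T, hT, hc⟩ := ih
    refine ⟨T.image (fun c => c / 5) ∪ T.image (fun c => c / 5 + 4 / 5), ?_, fun y hy => ?_⟩
    · refine (Finset.card_union_le _ _).trans ?_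
      have h1 := Finset.card_image_le (s := T) (f := fun c : ℝ => c / 5)
      have h2 := Finset.card_image_le (s := T) (f := fun c : ℝ => c / 5 + 4 / 5)
      rw [pow_succ]
      omega
    · obtain ⟨z, hz, h⟩ := hP y hy
      obtain ⟨c, hcT, hzc⟩ := hc z hz
      rw [abs_le] at hzc
      rcases h with rfl | rfl
      · refine ⟨c / 5, by simp only [Finset.mem_union, Finset.mem_image]; exact .inl ⟨c, hcT, rfl⟩,
          ?_⟩
        rw [abs_le, pow_succ]
        constructor <;> linarith
      · refine ⟨c / 5 + 4 / 5, by
          simp only [Finset.mem_union, Finset.mem_image]; exact .inr ⟨c, hcT, rfl⟩, ?_⟩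
        rw [abs_le, pow_succ]
        constructor <;> linarith

theorem exists_local_cover (h01 : P ⊆ Icc 0 1)
    (hP : ∀ y ∈ P, ∃ z ∈ P, y = z / 5 ∨ y = z / 5 + 4 / 5) (n m : ℕ) (x : ℝ) :
    ∃ T : Finset ℝ, T.card ≤ 2 ^ m ∧
      ∀ y ∈ P, |y - x| ≤ ((5 : ℝ)⁻¹) ^ n → ∃ c ∈ T, |y - c| ≤ ((5 : ℝ)⁻¹) ^ (n + m) := by
  induction n generalizing x with
  | zero =>
    obtain ⟨T, hT, hc⟩ := exists_cover_of_subset_Icc h01 hP m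
    refine ⟨T, hT, fun y hy _ => ?_⟩
    rw [Nat.zero_add]
    exact hc y hy
  | succ n ih =>
    have h1 : ((5 : ℝ)⁻¹) ^ n ≤ 1 := pow_le_one₀ (by norm_num) (by norm_num)
    have h2 : ((5 : ℝ)⁻¹) ^ (n + 1) = ((5 : ℝ)⁻¹) ^ n / 5 := by rw [pow_succ]; ring
    have h3 : ((5 : ℝ)⁻¹) ^ (n + 1 + m) = ((5 : ℝ)⁻¹) ^ (n + m) / 5 := by
      rw [Nat.add_right_comm, pow_succ]; ring
    rw [h2, h3]
    have key : ∀ d : ℝ, (∀ y ∈ P, |y - x| ≤ ((5 : ℝ)⁻¹) ^ n / 5 → ∃ z ∈ P, y = z / 5 + d) →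
        ∃ T : Finset ℝ, T.card ≤ 2 ^ m ∧ ∀ y ∈ P, |y - x| ≤ ((5 : ℝ)⁻¹) ^ n / 5 →
          ∃ c ∈ T, |y - c| ≤ ((5 : ℝ)⁻¹) ^ (n + m) / 5 := by
      intro d hd
      obtain ⟨T, hT, hc⟩ := ih (5 * (x - d))
      refine ⟨T.image (fun c => c / 5 + d), Finset.card_image_le.trans hT, fun y hy hyx => ?_⟩
      obtain ⟨z, hz, rfl⟩ := hd y hy hyx
      rw [abs_le] at hyx
      obtain ⟨c, hcT, hzc⟩ := hc z hz (by rw [abs_le]; constructor <;> linarith)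
      refine ⟨c / 5 + d, Finset.mem_image_of_mem _ hcT, ?_⟩
      rw [abs_le] at hzc ⊢
      constructor <;> linarith
    rcases le_total x (1 / 2) with hx | hx
    · refine key 0 fun y hy hyx => ?_
      rw [abs_le] at hyx
      obtain ⟨z, hz, h | h⟩ := hP y hy
      · exact ⟨z, hz, by rw [h, add_zero]⟩
      · have := (h01 hz).1
        linarith
    · refine key (4 / 5) fun y hy hyx => ?_
      rw [abs_le] at hyx
      obtain ⟨z, hz, h | h⟩ := hP y hy
      · have := (h01 hz).2
        linarith
      · exact ⟨z, hz, h⟩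

theorem exists_cover_rpow (h01 : P ⊆ Icc 0 1)
    (hP : ∀ y ∈ P, ∃ z ∈ P, y = z / 5 ∨ y = z / 5 + 4 / 5) {r ρ : ℝ} (hρ : 0 < ρ) (hρr : ρ < r)
    (hr : r ≤ 1) (x : ℝ) :
    ∃ T : Finset ℝ, (T.card : ℝ) ≤ 50 ^ (Real.log 2 / Real.log 5) *
        (r / ρ) ^ (Real.log 2 / Real.log 5) ∧
      ∀ y ∈ P, |y - x| < r → ∃ c ∈ T, |y - c| < ρ / 2 := by
  have hr0 : 0 < r := hρ.trans hρr
  obtain ⟨n, hn1, hn2⟩ := exists_nat_pow_near_of_lt_one hr0 hr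
    (show (0 : ℝ) < 5⁻¹ by norm_num) (by norm_num)
  obtain ⟨k, hk1, hk2⟩ := exists_nat_pow_near_of_lt_one (show 0 < ρ / 2 by positivity)
    (by linarith) (show (0 : ℝ) < 5⁻¹ by norm_num) (by norm_num)
  have hnk : n ≤ k + 1 := by
    by_contra! h
    have := pow_le_pow_of_le_one (show (0 : ℝ) ≤ 5⁻¹ by norm_num) (by norm_num) h.le
    linarith
  obtain ⟨m, hm⟩ := Nat.exists_eq_add_of_le hnk
  obtain ⟨T, hT, hc⟩ := exists_local_cover h01 hP n m x
  refine ⟨T, ?_, fun y hy hyx => ?_⟩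
  · have hl5 : 0 < Real.log 5 := Real.log_pos (by norm_num)
    have hs : 0 ≤ Real.log 2 / Real.log 5 :=
      div_nonneg (Real.log_nonneg (by norm_num)) hl5.le
    have h25 : (5 : ℝ) ^ (Real.log 2 / Real.log 5) = 2 := by
      rw [Real.rpow_def_of_pos (by norm_num), mul_div_cancel₀ _ hl5.ne',
        Real.exp_log (by norm_num)]
    have hm' : (5 : ℝ) ^ m ≤ 50 * (r / ρ) := by
      have e1 : ((5 : ℝ)⁻¹) ^ n = 5 ^ m * ((5 : ℝ)⁻¹) ^ (k + 1) := by
        rw [hm, pow_add, mul_left_comm, ← mul_pow]; norm_num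
      rw [← mul_div_assoc, le_div_iff₀ hρ]
      rw [pow_succ] at hn1
      have e2 : ((5 : ℝ)⁻¹) ^ (k + 1) = ((5 : ℝ)⁻¹) ^ k / 5 := by rw [pow_succ]; ring
      rw [e2] at e1
      have : (0 : ℝ) < 5 ^ m := by positivity
      nlinarith
    calc (T.card : ℝ) ≤ 2 ^ m := by exact_mod_cast hT
      _ = ((5 : ℝ) ^ m) ^ (Real.log 2 / Real.log 5) := by
        rw [← Real.rpow_pow_comm (by norm_num), h25]
      _ ≤ (50 * (r / ρ)) ^ (Real.log 2 / Real.log 5) :=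
        Real.rpow_le_rpow (by positivity) hm' hs
      _ = _ := Real.mul_rpow (by norm_num) (by positivity)
  · obtain ⟨c, hcT, h⟩ := hc y hy (hyx.le.trans hn2)
    rw [← hm] at h
    exact ⟨c, hcT, h.trans_lt hk1⟩

end Cantor

theorem exists_interval_cover {r ρ : ℝ} (hρ : 0 < ρ) (hρr : ρ < r) (x : ℝ) :
    ∃ T : Finset ℝ, (T.card : ℝ) ≤ 5 * (r / ρ) ∧
      ∀ y, |y - x| < r → ∃ c ∈ T, |y - c| < ρ / 2 := by
  have h1 : 1 ≤ r / ρ := (one_le_div hρ).2 hρr.le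
  refine ⟨(Finset.range (⌊4 * (r / ρ)⌋₊ + 1)).image (fun j : ℕ => x - r + j * (ρ / 2)), ?_,
    fun y hy => ?_⟩
  · have h2 := Finset.card_image_le (s := Finset.range (⌊4 * (r / ρ)⌋₊ + 1))
      (f := fun j : ℕ => x - r + j * (ρ / 2))
    rw [Finset.card_range] at h2
    have h3 : (((Finset.range (⌊4 * (r / ρ)⌋₊ + 1)).image
      (fun j : ℕ => x - r + j * (ρ / 2))).card : ℝ) ≤ ⌊4 * (r / ρ)⌋₊ + 1 := by exact_mod_cast h2
    have h4 := Nat.floor_le (show 0 ≤ 4 * (r / ρ) by positivity)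
    linarith
  · rw [abs_lt] at hy
    have h0 : 0 ≤ (y - x + r) / (ρ / 2) := div_nonneg (by linarith) (by linarith)
    have hle : (y - x + r) / (ρ / 2) ≤ 4 * (r / ρ) := by
      rw [div_le_iff₀ (by positivity)]
      have : 4 * (r / ρ) * (ρ / 2) = 2 * r := by field_simp; ring
      linarith
    refine ⟨_, Finset.mem_image_of_mem _ (Finset.mem_range.2
      (Nat.lt_succ_of_le (Nat.floor_le_floor hle))), ?_⟩
    have e1 := Nat.floor_le h0
    have e2 := Nat.lt_floor_add_one ((y - x + r) / (ρ / 2))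
    rw [le_div_iff₀ (by positivity)] at e1
    rw [div_lt_iff₀ (by positivity)] at e2
    rw [abs_lt]
    constructor <;> linarith

theorem dist_le_sum_abs (x y : EuclideanSpace ℝ (Fin 2)) :
    dist x y ≤ |x 0 - y 0| + |x 1 - y 1| := by
  rw [EuclideanSpace.dist_eq, Fin.sum_univ_two, Real.dist_eq, Real.dist_eq]
  apply Real.sqrt_le_iff.2
  constructor
  · positivity
  · nlinarith [abs_nonneg (x 0 - y 0), abs_nonneg (x 1 - y 1)]

theorem abs_sub_apply_le_dist (x y : EuclideanSpace ℝ (Fin 2)) (i : Fin 2) :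
    |x i - y i| ≤ dist x y := by
  rw [dist_eq_norm, ← Real.norm_eq_abs]
  exact PiLp.norm_apply_le (x - y) i

/-- A planar set whose second coordinates lie in a Cantor set with two pieces of ratio `1/5`
satisfies Assouad covering bounds with exponent `1 + log 2 / log 5`. -/
theorem exists_planar_cover {F : Set (EuclideanSpace ℝ (Fin 2))} {P : Set ℝ}
    (hFP : ∀ x ∈ F, x 1 ∈ P) (h01 : P ⊆ Icc 0 1)
    (hP : ∀ y ∈ P, ∃ z ∈ P, y = z / 5 ∨ y = z / 5 + 4 / 5) {r ρ : ℝ} (hρ : 0 < ρ) (hρr : ρ < r)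
    (hr : r ≤ 1) (x : EuclideanSpace ℝ (Fin 2)) :
    ∃ T : Finset (EuclideanSpace ℝ (Fin 2)), (F ∩ Metric.ball x r ⊆ ⋃ y ∈ T, Metric.ball y ρ) ∧
      (T.card : ℝ) ≤ 5 * 50 ^ (Real.log 2 / Real.log 5) *
        (r / ρ) ^ (1 + Real.log 2 / Real.log 5) := by
  classical
  obtain ⟨A, hA, hAc⟩ := exists_interval_cover hρ hρr (x 0)
  obtain ⟨B, hB, hBc⟩ := exists_cover_rpow h01 hP hρ hρr hr (x 1)
  refine ⟨(A ×ˢ B).image fun c => !₂[c.1, c.2], fun y hy => ?_, ?_⟩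
  · have hd := Metric.mem_ball.1 hy.2
    obtain ⟨a, ha, h0⟩ := hAc (y 0) ((abs_sub_apply_le_dist y x 0).trans_lt hd)
    obtain ⟨b, hb, h1⟩ := hBc (y 1) (hFP y hy.1) ((abs_sub_apply_le_dist y x 1).trans_lt hd)
    refine Set.mem_biUnion (x := !₂[a, b]) ?_ ?_
    · exact Finset.mem_coe.2 (Finset.mem_image.2 ⟨(a, b), Finset.mem_product.2 ⟨ha, hb⟩, rfl⟩)
    · refine Metric.mem_ball.2 ((dist_le_sum_abs _ _).trans_lt ?_)
      have e0 : (!₂[a, b] : EuclideanSpace ℝ (Fin 2)) 0 = a := rfl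
      have e1 : (!₂[a, b] : EuclideanSpace ℝ (Fin 2)) 1 = b := rfl
      rw [e0, e1]
      linarith
  · have hpos : 0 < r / ρ := div_pos (hρ.trans hρr) hρ
    have h1 := Finset.card_image_le (s := A ×ˢ B)
      (f := fun c => (!₂[c.1, c.2] : EuclideanSpace ℝ (Fin 2)))
    rw [Finset.card_product] at h1
    have h2 : (((A ×ˢ B).image fun c => (!₂[c.1, c.2] : EuclideanSpace ℝ (Fin 2))).card : ℝ) ≤
      A.card * B.card := by exact_mod_cast h1
    refine h2.trans ((mul_le_mul hA hB (Nat.cast_nonneg _) (by positivity)).trans_eq ?_)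
    rw [Real.rpow_add hpos, Real.rpow_one]
    ring

section Contraction

variable {V : Type*} [NormedAddCommGroup V] [NormedSpace ℝ V] {F : Set V}

theorem fixedPoint_mem (hF : IsClosed F) (hne : F.Nonempty) {v : V}
    (h : ∀ x ∈ F, (5 : ℝ)⁻¹ • x + (4 / 5 : ℝ) • v ∈ F) : v ∈ F := by
  obtain ⟨x, hx⟩ := hne
  have hmem : ∀ n : ℕ, v + ((5 : ℝ)⁻¹) ^ n • (x - v) ∈ F := by
    intro n
    induction n with
    | zero => simpa using hx
    | succ n ih =>
      convert h _ ih using 1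
      rw [pow_succ', mul_smul, smul_add, add_right_comm, ← add_smul]
      norm_num
  have hl : Tendsto (fun n : ℕ => v + ((5 : ℝ)⁻¹) ^ n • (x - v)) atTop (𝓝 (v + (0 : ℝ) • (x - v))) :=
    tendsto_const_nhds.add ((tendsto_pow_atTop_nhds_zero_of_lt_one (by norm_num)
      (by norm_num)).smul_const _)
  rw [zero_smul, add_zero] at hl
  exact hF.mem_of_tendsto hl (Eventually.of_forall hmem)

theorem exists_cover_closedBall {ι : Type*} [Fintype ι] {c : ι → V} {B : ℝ}
    (hB : ∀ x ∈ F, ‖x‖ ≤ B) (h : ∀ x ∈ F, ∃ y ∈ F, ∃ i, x = (5 : ℝ)⁻¹ • y + c i) (n : ℕ) :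
    ∃ T : Finset V, T.card ≤ Fintype.card ι ^ n ∧
      ∀ x ∈ F, ∃ z ∈ T, x ∈ closedBall z (B * ((5 : ℝ)⁻¹) ^ n) := by
  classical
  induction n with
  | zero => exact ⟨{0}, by simp, fun x hx => ⟨0, by simp, by simpa using hB x hx⟩⟩
  | succ n ih =>
    obtain ⟨T, hT, hc⟩ := ih
    refine ⟨(T ×ˢ Finset.univ).image fun p : V × ι => (5 : ℝ)⁻¹ • p.1 + c p.2, ?_, fun x hx => ?_⟩
    · refine Finset.card_image_le.trans ?_
      rw [Finset.card_product, pow_succ, Finset.card_univ]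
      exact Nat.mul_le_mul_right _ hT
    · obtain ⟨y, hy, i, rfl⟩ := h x hx
      obtain ⟨z, hz, hyz⟩ := hc y hy
      refine ⟨(5 : ℝ)⁻¹ • z + c i, Finset.mem_image.2
        ⟨(z, i), Finset.mem_product.2 ⟨hz, Finset.mem_univ _⟩, rfl⟩, ?_⟩
      rw [mem_closedBall, dist_eq_norm] at hyz ⊢
      rw [add_sub_add_right_eq_sub, ← smul_sub, norm_smul, pow_succ, Real.norm_eq_abs,
        abs_of_pos (by norm_num)]
      linarith

theorem dimH_le_of_contractions [MeasurableSpace V] [BorelSpace V] {ι : Type*} [Fintype ι]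
    [Nonempty ι] {c : ι → V} (hF : Bornology.IsBounded F)
    (h : ∀ x ∈ F, ∃ y ∈ F, ∃ i, x = (5 : ℝ)⁻¹ • y + c i) :
    dimH F ≤ ENNReal.ofReal (Real.log (Fintype.card ι) / Real.log 5) := by
  obtain ⟨B, hB0, hB⟩ := hF.exists_pos_norm_le
  set s : ℝ := Real.log (Fintype.card ι) / Real.log 5 with hs
  have hcard : (1 : ℝ) ≤ Fintype.card ι := by exact_mod_cast Fintype.card_pos
  have hl5 : 0 < Real.log 5 := Real.log_pos (by norm_num)
  have hs0 : 0 ≤ s := div_nonneg (Real.log_nonneg hcard) hl5.le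
  have h5s : (5 : ℝ) ^ s = Fintype.card ι := by
    rw [Real.rpow_def_of_pos (by norm_num), hs, mul_div_cancel₀ _ hl5.ne',
      Real.exp_log (by linarith)]
  choose T hTcard hTcov using exists_cover_closedBall hB h
  have hdiam : ∀ n (i : T n), Metric.ediam (closedBall (i : V) (B * ((5 : ℝ)⁻¹) ^ n)) ≤
      ENNReal.ofReal (2 * (B * ((5 : ℝ)⁻¹) ^ n)) := by
    intro n i
    refine Metric.ediam_le fun x hx y hy => ?_
    rw [edist_dist]
    refine ENNReal.ofReal_le_ofReal ?_
    have := dist_triangle_right x y (i : V)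
    rw [mem_closedBall] at hx hy
    linarith
  have hr : Tendsto (fun n : ℕ => ENNReal.ofReal (2 * (B * ((5 : ℝ)⁻¹) ^ n))) atTop (𝓝 0) := by
    have h1 := (tendsto_pow_atTop_nhds_zero_of_lt_one (r := (5 : ℝ)⁻¹) (by norm_num)
      (by norm_num)).const_mul B |>.const_mul 2
    simpa using ENNReal.tendsto_ofReal h1
  have hmeas := Measure.hausdorffMeasure_le_liminf_sum s F _ hr
    (fun n (i : T n) => closedBall (i : V) (B * ((5 : ℝ)⁻¹) ^ n)) (Eventually.of_forall hdiam)
    (Eventually.of_forall fun n x hx => by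
      obtain ⟨z, hz, hxz⟩ := hTcov n x hx
      exact Set.mem_iUnion.2 ⟨⟨z, hz⟩, hxz⟩)
  have hsum : ∀ n, ∑ i : T n, Metric.ediam (closedBall (i : V) (B * ((5 : ℝ)⁻¹) ^ n)) ^ s ≤
      ENNReal.ofReal ((2 * B) ^ s) := by
    intro n
    have hn : (((5 : ℝ)⁻¹) ^ n) ^ s * (Fintype.card ι : ℝ) ^ n = 1 := by
      rw [← h5s, ← Real.rpow_pow_comm (by norm_num), ← mul_pow, Real.inv_rpow (by norm_num),
        inv_mul_cancel₀ (by positivity), one_pow]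
    calc _ ≤ ∑ i : T n, ENNReal.ofReal ((2 * (B * ((5 : ℝ)⁻¹) ^ n)) ^ s) :=
          Finset.sum_le_sum fun i _ => by
            rw [← ENNReal.ofReal_rpow_of_nonneg (by positivity) hs0]
            exact ENNReal.rpow_le_rpow (hdiam n i) hs0
      _ = ENNReal.ofReal ((T n).card * (2 * (B * ((5 : ℝ)⁻¹) ^ n)) ^ s) := by
        rw [Finset.sum_const, nsmul_eq_mul, Finset.card_univ, Fintype.card_coe,
          ENNReal.ofReal_mul (Nat.cast_nonneg _), ENNReal.ofReal_natCast]
      _ ≤ _ := ENNReal.ofReal_le_ofReal <| by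
        have h1 : ((T n).card : ℝ) ≤ (Fintype.card ι : ℝ) ^ n := by exact_mod_cast hTcard n
        rw [← mul_assoc, Real.mul_rpow (by positivity) (by positivity)]
        have h2 : 0 ≤ (2 * B) ^ s * (((5 : ℝ)⁻¹) ^ n) ^ s := by positivity
        refine (mul_le_mul_of_nonneg_right h1 h2).trans_eq ?_
        rw [mul_comm, mul_assoc, hn, mul_one]
  have hfin : μH[s] F ≤ ENNReal.ofReal ((2 * B) ^ s) :=
    hmeas.trans ((liminf_le_liminf (Eventually.of_forall hsum)).trans_eq (liminf_const _))
  have hlt := hfin.trans_lt ENNReal.ofReal_lt_top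
  rw [← Real.coe_toNNReal s hs0] at hlt
  exact dimH_le_of_hausdorffMeasure_ne_top hlt.ne

end Contraction

theorem affineSpan_eq_top_of_unit_triangle {F : Set (EuclideanSpace ℝ (Fin 2))} (h0 : 0 ∈ F)
    (h1 : EuclideanSpace.single 0 1 ∈ F) (h2 : EuclideanSpace.single 1 1 ∈ F) :
    affineSpan ℝ F = ⊤ := by
  refine eq_top_iff.2 fun p _ => ?_
  have m0 := subset_affineSpan ℝ F h0
  have m1 := (affineSpan ℝ F).smul_vsub_vadd_mem (p 0) (subset_affineSpan ℝ F h1) m0 m0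
  have m2 := (affineSpan ℝ F).smul_vsub_vadd_mem (p 1) (subset_affineSpan ℝ F h2) m0 m1
  convert m2 using 1
  ext i
  fin_cases i <;> simp

/-- A bounded set of reals that is reproduced by `y ↦ y/5` and `y ↦ y/5 + 4/5` lies in `[0, 1]`. -/
theorem subset_Icc_of_cantor {P : Set ℝ} (hcomp : IsCompact P)
    (hP : ∀ y ∈ P, ∃ z ∈ P, y = z / 5 ∨ y = z / 5 + 4 / 5) : P ⊆ Icc 0 1 := by
  intro y hy
  obtain ⟨a, ha, hmin⟩ := hcomp.exists_isLeast ⟨y, hy⟩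
  obtain ⟨b, hb, hmax⟩ := hcomp.exists_isGreatest ⟨y, hy⟩
  obtain ⟨a', ha', h⟩ := hP a ha
  obtain ⟨b', hb', h'⟩ := hP b hb
  have h1 := hmin ha'
  have h2 := hmax hb'
  have h3 := hmin hy
  have h4 := hmax hy
  constructor
  · rcases h with h | h <;> linarith
  · rcases h' with h' | h' <;> linarith

/-- **A planar self-similar set with intermediate Assouad dimension.**
Let `t = 4 ∑_{k≥0} 5^{-2^k}` and let `F ⊆ [0,1]²` be the attractor of the four maps
`x/5`, `x/5 + (t/5, 0)`, `x/5 + (4/5, 0)`, `x/5 + (0, 4/5)` on `ℝ²`.  Then `F` is not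
contained in any line, and
`dim_H F ≤ log 4 / log 5 < 1 ≤ dim_A F ≤ 1 + log 2 / log 5 < 2`. -/
theorem planar_intermediate_assouad (t : ℝ)
    (ht : t = 4 * ∑' k : ℕ, ((5 : ℝ)⁻¹) ^ (2 ^ k))
    (S : Fin 4 → EuclideanSpace ℝ (Fin 2) → EuclideanSpace ℝ (Fin 2))
    (hS : S = ![fun x => (5 : ℝ)⁻¹ • x,
        fun x => (5 : ℝ)⁻¹ • x + (EuclideanSpace.equiv (Fin 2) ℝ).symm ![t / 5, 0],
        fun x => (5 : ℝ)⁻¹ • x + (EuclideanSpace.equiv (Fin 2) ℝ).symm ![4 / 5, 0],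
        fun x => (5 : ℝ)⁻¹ • x + (EuclideanSpace.equiv (Fin 2) ℝ).symm ![0, 4 / 5]])
    (F : Set (EuclideanSpace ℝ (Fin 2))) (hFcomp : IsCompact F) (hFne : F.Nonempty)
    (hFattr : F = ⋃ i, S i '' F) :
    affineSpan ℝ F = ⊤ ∧
    dimH F ≤ ENNReal.ofReal (Real.log 4 / Real.log 5) ∧
    Real.log 4 / Real.log 5 < 1 ∧
    1 ≤ assouadDim F ∧
    assouadDim F ≤ 1 + Real.log 2 / Real.log 5 ∧
    1 + Real.log 2 / Real.log 5 < 2 := by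
  have hone : ‖(EuclideanSpace.single 0 1 : EuclideanSpace ℝ (Fin 2))‖ = 1 := by simp
  set e₀ : EuclideanSpace ℝ (Fin 2) := EuclideanSpace.single 0 1 with he₀
  set e₁ : EuclideanSpace ℝ (Fin 2) := EuclideanSpace.single 1 1 with he₁
  let c : Fin 4 → EuclideanSpace ℝ (Fin 2) := ![0, (t / 5) • e₀, (4 / 5 : ℝ) • e₀, (4 / 5 : ℝ) • e₁]
  have hSc : ∀ i x, S i x = (5 : ℝ)⁻¹ • x + c i := by
    intro i x
    subst hS
    ext j
    fin_cases i <;> fin_cases j <;> simp [c, he₀, he₁]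
  have hmap : ∀ i, ∀ x ∈ F, (5 : ℝ)⁻¹ • x + c i ∈ F := by
    intro i x hx
    rw [← hSc, hFattr]
    exact Set.mem_iUnion.2 ⟨i, x, hx, rfl⟩
  have hcov : ∀ x ∈ F, ∃ y ∈ F, ∃ i, x = (5 : ℝ)⁻¹ • y + c i := by
    intro x hx
    rw [hFattr] at hx
    obtain ⟨i, y, hy, rfl⟩ := Set.mem_iUnion.1 hx
    exact ⟨y, hy, i, hSc i y⟩
  have hl5 : 0 < Real.log 5 := Real.log_pos (by norm_num)
  have hshift : ∀ (i : Fin 4) (a : ℝ), c i = (a / 5) • e₀ → a ∈ shiftSet F e₀ 1 := by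
    intro i a hi x hx
    have h := hmap i x hx
    rw [hi] at h
    convert h using 1
    rw [pow_one, smul_add, smul_smul, inv_mul_eq_div]
  have h0 : (0 : ℝ) ∈ shiftSet F e₀ 1 := hshift 0 0 (by simp [c])
  have h_t : t ∈ shiftSet F e₀ 1 := hshift 1 t rfl
  have h4 : (4 : ℝ) ∈ shiftSet F e₀ 1 := hshift 2 4 rfl
  have hPcov : ∀ y ∈ (fun x : EuclideanSpace ℝ (Fin 2) => x 1) '' F,
      ∃ z ∈ (fun x : EuclideanSpace ℝ (Fin 2) => x 1) '' F, y = z / 5 ∨ y = z / 5 + 4 / 5 := by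
    rintro _ ⟨x, hx, rfl⟩
    obtain ⟨y, hy, i, rfl⟩ := hcov x hx
    refine ⟨y 1, ⟨y, hy, rfl⟩, ?_⟩
    fin_cases i <;> simp [c, he₀, he₁, inv_mul_eq_div]
  have hP01 := subset_Icc_of_cantor (hFcomp.image (by fun_prop)) hPcov
  have hmem : 1 + Real.log 2 / Real.log 5 ∈ {s : ℝ | 0 ≤ s ∧ ∃ K : ℝ, 0 < K ∧
      ∀ r ρ : ℝ, 0 < ρ → ρ < r → r ≤ 1 → ∀ x ∈ F, ∃ T : Finset (EuclideanSpace ℝ (Fin 2)),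
        (F ∩ Metric.ball x r ⊆ ⋃ y ∈ T, Metric.ball y ρ) ∧ (T.card : ℝ) ≤ K * (r / ρ) ^ s} := by
    refine ⟨?_, 5 * 50 ^ (Real.log 2 / Real.log 5), by positivity, fun r ρ hρ hρr hr x _ =>
      exists_planar_cover (fun x hx => Set.mem_image_of_mem _ hx) hP01 hPcov hρ hρr hr x⟩
    have : 0 < Real.log 2 := Real.log_pos (by norm_num)
    positivity
  refine ⟨?_, ?_, ?_, ?_, ?_, ?_⟩
  · exact affineSpan_eq_top_of_unit_triangle
      (fixedPoint_mem hFcomp.isClosed hFne fun x hx => by simpa [c] using hmap 0 x hx)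
      (fixedPoint_mem hFcomp.isClosed hFne (hmap 2)) (fixedPoint_mem hFcomp.isClosed hFne (hmap 3))
  · simpa using dimH_le_of_contractions hFcomp.isBounded hcov
  · rw [div_lt_one hl5]
    exact Real.log_lt_log (by norm_num) (by norm_num)
  · unfold assouadDim
    refine le_csInf ⟨_, hmem⟩ ?_
    rintro s ⟨_, K, _, hK⟩
    exact one_le_of_shift_chain hone hFne (fun η hη N => exists_shift_chain h0
      (fun δ hδ => exists_close_shifts ht h0 h4 h_t hδ) hη N) hK
  · exact csInf_le (BddBelow.mono (fun s hs => hs.1) (bddBelow_Ici (a := (0 : ℝ)))) hmem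
  · have : Real.log 2 / Real.log 5 < 1 := by
      rw [div_lt_one hl5]
      exact Real.log_lt_log (by norm_num) (by norm_num)
    linarith
end

section
/- Let d ∈ ℕ, let Λ = {0,1}^d be the set of corners of [0,1]^d, and let α, β, γ ∈ (0,1) with (log β)/(log α) irrational. Consider the IFS on [0,1]^d consisting of the 1 + 2^d maps S_α(x) = αx, S_β(x) = βx, and S_γ^z(x) = γx + (1−γ)z for z ∈ Λ \ {(0,…,0)}, with attractor F ⊆ [0,1]^d. Then [0,1]^d is a weak tangent of F (with reference set X = [0,1]^d), and consequently dim_A F = d. -/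
open Set Metric Filter Function MeasureTheory

/-- `F` contains, up to arbitrarily small relative error, a homothetic copy of every finite
subset of `A`. -/
def ContainsApproxCopies {E : Type*} [NormedAddCommGroup E] [NormedSpace ℝ E]
    (F A : Set E) : Prop :=
  ∀ S : Finset E, (∀ s ∈ S, s ∈ A) → ∀ ε : ℝ, 0 < ε → ∃ l : ℝ, 0 < l ∧ ∃ p : E,
    ∀ s ∈ S, ∃ f ∈ F, ‖f - (p + l • s)‖ ≤ ε * l

/-- If `log β / log α` is irrational, then the products `α ^ m * β ^ n` with integer exponents
are dense in `(0, ∞)`. -/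
lemma exists_zpow_mul_zpow_near {α β : ℝ} (hα : 0 < α) (hβ : 0 < β)
    (hirr : Irrational (Real.log β / Real.log α)) {t δ : ℝ} (ht : 0 < t) (hδ : 0 < δ) :
    ∃ m n : ℤ, |α ^ m * β ^ n - t| < δ := by
  have hd : Dense (AddSubgroup.closure {Real.log β, Real.log α} : Set ℝ) :=
    dense_addSubgroupClosure_pair_iff.2 hirr
  have hopen : IsOpen (Real.exp ⁻¹' Metric.ball t δ) :=
    Metric.isOpen_ball.preimage Real.continuous_exp
  obtain ⟨y, hy, hyc⟩ := hd.inter_open_nonempty _ hopen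
    ⟨Real.log t, by simp [Real.exp_log ht, hδ]⟩
  obtain ⟨n, m, rfl⟩ := AddSubgroup.mem_closure_pair.1 hyc
  refine ⟨m, n, ?_⟩
  have h1 : Real.exp (n • Real.log β + m • Real.log α) = α ^ m * β ^ n := by
    rw [← Real.rpow_intCast, ← Real.rpow_intCast, Real.rpow_def_of_pos hα,
      Real.rpow_def_of_pos hβ, ← Real.exp_add, zsmul_eq_mul, zsmul_eq_mul]
    ring_nf
  rw [← h1, ← Real.dist_eq]
  exact hy

/-- Finitely many positive reals are simultaneously approximated, up to a common factor, by
products `α ^ a * β ^ b` with natural exponents. -/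
lemma exists_common_scale {ι : Type*} {α β : ℝ} (hα : 0 < α) (hβ : 0 < β)
    (hirr : Irrational (Real.log β / Real.log α)) (S : Finset ι) (t : ι → ℝ)
    (ht : ∀ s ∈ S, 0 < t s) {δ : ℝ} (hδ : 0 < δ) :
    ∃ L : ℝ, 0 < L ∧ ∀ s ∈ S, ∃ a b : ℕ, |α ^ a * β ^ b - L * t s| ≤ δ * L := by
  have h : ∀ s, ∃ m n : ℤ, s ∈ S → |α ^ m * β ^ n - t s| < δ := by
    intro s
    by_cases hs : s ∈ S
    · obtain ⟨m, n, h⟩ := exists_zpow_mul_zpow_near hα hβ hirr (ht s hs) hδ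
      exact ⟨m, n, fun _ => h⟩
    · exact ⟨0, 0, fun h => absurd h hs⟩
  choose m n hmn using h
  set N : ℕ := ∑ s ∈ S, ((m s).natAbs + (n s).natAbs) with hN
  have hL : 0 < (α * β) ^ N := by positivity
  refine ⟨(α * β) ^ N, hL, fun s hs => ?_⟩
  have hle : (m s).natAbs + (n s).natAbs ≤ N :=
    Finset.single_le_sum (f := fun s => (m s).natAbs + (n s).natAbs)
      (fun _ _ => Nat.zero_le _) hs
  refine ⟨(N + m s).toNat, (N + n s).toNat, ?_⟩
  have ha : α ^ (N + m s).toNat = α ^ N * α ^ (m s) := by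
    rw [← zpow_natCast, Int.toNat_of_nonneg (by omega), zpow_add₀ hα.ne', zpow_natCast]
  have hb : β ^ (N + n s).toNat = β ^ N * β ^ (n s) := by
    rw [← zpow_natCast, Int.toNat_of_nonneg (by omega), zpow_add₀ hβ.ne', zpow_natCast]
  have : α ^ (N + m s).toNat * β ^ (N + n s).toNat - (α * β) ^ N * t s
      = (α ^ m s * β ^ n s - t s) * (α * β) ^ N := by
    rw [ha, hb]; ring
  rw [this, abs_mul, abs_of_pos hL]
  gcongr
  exact (hmn s hs).le

section Invariant

variable {E : Type*} [NormedAddCommGroup E] [NormedSpace ℝ E]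

lemma pow_smul_mem_of_smul_mem {F : Set E} {α : ℝ} (hF : ∀ f ∈ F, α • f ∈ F) (n : ℕ)
    {f : E} (hf : f ∈ F) : α ^ n • f ∈ F := by
  induction n with
  | zero => simpa
  | succ n ih => rw [pow_succ', mul_smul]; exact hF _ ih

lemma add_pow_smul_sub_mem {F : Set E} {γ : ℝ} {z : E}
    (hF : ∀ f ∈ F, γ • f + (1 - γ) • z ∈ F) (n : ℕ) {f : E} (hf : f ∈ F) :
    z + γ ^ n • (f - z) ∈ F := by
  induction n with
  | zero => simpa
  | succ n ih =>
    convert hF _ ih using 1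
    rw [pow_succ']
    module

/-- Zooming in near the fixed point `z` adds the line `ℝ z` to `F`. -/
lemma exists_approx_line_add {F : Set E} {α β γ : ℝ} (hα : 0 < α) (hβ : 0 < β)
    (hγ : 0 < γ) (hγ1 : γ < 1) (hirr : Irrational (Real.log β / Real.log α))
    (hFα : ∀ f ∈ F, α • f ∈ F) (hFβ : ∀ f ∈ F, β • f ∈ F) {z : E}
    (hFγ : ∀ f ∈ F, γ • f + (1 - γ) • z ∈ F) {ι : Type*} (S : Finset ι) (c : ι → ℝ)
    (f : ι → E) (hf : ∀ s ∈ S, f s ∈ F) {ε : ℝ} (hε : 0 < ε) :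
    ∃ l : ℝ, 0 < l ∧ ∃ p : E, ∀ s ∈ S, ∃ g ∈ F,
      ‖g - (p + l • (c s • z + f s))‖ ≤ ε * l := by
  set M : ℝ := ∑ s ∈ S, (|c s + 1| * ‖f s - z‖ + |c s + 1|) with hM
  have hM0 : 0 ≤ M := Finset.sum_nonneg fun _ _ => by positivity
  have hMs : ∀ s ∈ S, |c s + 1| * ‖f s - z‖ + |c s + 1| ≤ M := fun s hs =>
    Finset.single_le_sum (f := fun s => |c s + 1| * ‖f s - z‖ + |c s + 1|)
      (fun _ _ => by positivity) hs
  obtain ⟨n, hn⟩ := exists_pow_lt_of_lt_one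
    (show 0 < min (ε / 2) (1 / 2) / (M + 1) by positivity) hγ1
  set η := γ ^ n with hη
  have hη0 : 0 < η := by positivity
  rw [lt_div_iff₀ (by positivity)] at hn
  have hn1 : η * M ≤ ε / 2 := by
    have := min_le_left (ε / 2) (1 / 2 : ℝ); nlinarith
  have hn2 : η * M ≤ 1 / 2 := by
    have := min_le_right (ε / 2) (1 / 2 : ℝ); nlinarith
  set w : ι → E := fun s => z + η • (f s - z) with hw
  set B : ℝ := ∑ s ∈ S, ‖w s‖ with hB
  have hB0 : 0 ≤ B := Finset.sum_nonneg fun _ _ => norm_nonneg _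
  have hBs : ∀ s ∈ S, ‖w s‖ ≤ B := fun s hs =>
    Finset.single_le_sum (f := fun s => ‖w s‖) (fun _ _ => norm_nonneg _) hs
  have ht : ∀ s ∈ S, 0 < 1 + η * (c s + 1) := by
    intro s hs
    have h1 : |c s + 1| ≤ M := le_trans (le_add_of_nonneg_left (by positivity)) (hMs s hs)
    have h2 := neg_abs_le (c s + 1)
    nlinarith
  obtain ⟨L, hL, hab⟩ := exists_common_scale hα hβ hirr S (fun s => 1 + η * (c s + 1)) ht
    (show 0 < η * (ε / 2) / (B + 1) by positivity)
  refine ⟨L * η, by positivity, L • z, fun s hs => ?_⟩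
  obtain ⟨a, b, h⟩ := hab s hs
  refine ⟨(α ^ a * β ^ b) • w s, ?_, ?_⟩
  · rw [mul_smul]
    exact pow_smul_mem_of_smul_mem hFα a
      (pow_smul_mem_of_smul_mem hFβ b (add_pow_smul_sub_mem hFγ n (hf s hs)))
  have key : (α ^ a * β ^ b) • w s - (L • z + (L * η) • (c s • z + f s))
      = (α ^ a * β ^ b - L * (1 + η * (c s + 1))) • w s
        + (L * η * η * (c s + 1)) • (f s - z) := by
    simp only [hw]; module
  rw [key]
  refine (norm_add_le _ _).trans ?_
  rw [norm_smul, norm_smul, Real.norm_eq_abs, Real.norm_eq_abs, abs_mul,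
    abs_of_pos (show 0 < L * η * η by positivity)]
  have e1 : |α ^ a * β ^ b - L * (1 + η * (c s + 1))| * ‖w s‖ ≤ η * (ε / 2) * L := by
    calc _ ≤ η * (ε / 2) / (B + 1) * L * (B + 1) := by
          gcongr
          exact (hBs s hs).trans (by linarith)
      _ = _ := by field_simp
  have e2 : L * η * η * |c s + 1| * ‖f s - z‖ ≤ L * η * (ε / 2) := by
    have h1 : |c s + 1| * ‖f s - z‖ ≤ M :=
      (le_add_of_nonneg_right (by positivity)).trans (hMs s hs)
    calc _ = L * η * (η * (|c s + 1| * ‖f s - z‖)) := by ring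
      _ ≤ L * η * (η * M) := by gcongr
      _ ≤ _ := by gcongr
  linarith

/-- Zooming in twice: if `F` approximately contains copies of `V + F`, where `V` is a cone, it
approximately contains copies of `V + ℝ z + F`. -/
lemma ContainsApproxCopies.add_line {F : Set E} {α β γ : ℝ} (hα : 0 < α) (hβ : 0 < β)
    (hγ : 0 < γ) (hγ1 : γ < 1) (hirr : Irrational (Real.log β / Real.log α))
    (hFα : ∀ f ∈ F, α • f ∈ F) (hFβ : ∀ f ∈ F, β • f ∈ F) {z : E}
    (hFγ : ∀ f ∈ F, γ • f + (1 - γ) • z ∈ F) {V : Set E}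
    (hV : ∀ v ∈ V, ∀ l : ℝ, 0 < l → l • v ∈ V)
    (h : ContainsApproxCopies F {x | ∃ v ∈ V, ∃ f ∈ F, x = v + f}) :
    ContainsApproxCopies F {x | ∃ v ∈ V, ∃ c : ℝ, ∃ f ∈ F, x = v + c • z + f} := by
  classical
  intro S hS ε hε
  have hS' : ∀ s, ∃ (v : E) (c : ℝ) (f : E), s ∈ S → v ∈ V ∧ f ∈ F ∧ s = v + c • z + f := by
    intro s
    by_cases hs : s ∈ S
    · obtain ⟨v, hv, c, f, hf, e⟩ := hS s hs
      exact ⟨v, c, f, fun _ => ⟨hv, hf, e⟩⟩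
    · exact ⟨0, 0, 0, fun h => absurd h hs⟩
  choose v c f hvcf using hS'
  obtain ⟨l, hl, p, hg⟩ := exists_approx_line_add hα hβ hγ hγ1 hirr hFα hFβ hFγ S c f
    (fun s hs => (hvcf s hs).2.1) (half_pos hε)
  choose! g hgF hgn using hg
  obtain ⟨m, hm, q, hq⟩ := h (S.image fun s => l • v s + g s)
    (by
      intro x hx
      obtain ⟨s, hs, rfl⟩ := Finset.mem_image.1 hx
      exact ⟨_, hV _ (hvcf s hs).1 l hl, _, hgF s hs, rfl⟩)
    (ε / 2 * l) (by positivity)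
  refine ⟨m * l, by positivity, q + m • p, fun s hs => ?_⟩
  obtain ⟨k, hkF, hk⟩ := hq _ (Finset.mem_image_of_mem _ hs)
  refine ⟨k, hkF, ?_⟩
  have e : k - (q + m • p + (m * l) • s) = (k - (q + m • (l • v s + g s)))
      + m • (g s - (p + l • (c s • z + f s))) := by
    conv_lhs => rw [(hvcf s hs).2.2]
    module
  rw [e]
  refine (norm_add_le _ _).trans ?_
  rw [norm_smul, Real.norm_of_nonneg hm.le]
  nlinarith [hgn s hs]

/-- The copies may be taken arbitrarily small if `F` is invariant under a contraction. -/
lemma ContainsApproxCopies.exists_scale_le {F A : Set E} (h : ContainsApproxCopies F A)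
    {α : ℝ} (hα : 0 < α) (hα1 : α < 1) (hFα : ∀ f ∈ F, α • f ∈ F) (S : Finset E)
    (hS : ∀ s ∈ S, s ∈ A) {ε η : ℝ} (hε : 0 < ε) (hη : 0 < η) :
    ∃ l : ℝ, 0 < l ∧ l ≤ η ∧ ∃ p : E, ∀ s ∈ S, ∃ f ∈ F, ‖f - (p + l • s)‖ ≤ ε * l := by
  obtain ⟨l, hl, p, hf⟩ := h S hS ε hε
  obtain ⟨n, hn⟩ := exists_pow_lt_of_lt_one (show 0 < η / l by positivity) hα1
  refine ⟨α ^ n * l, by positivity, ((lt_div_iff₀ hl).1 hn).le, α ^ n • p, fun s hs => ?_⟩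
  obtain ⟨f, hfF, hfn⟩ := hf s hs
  refine ⟨α ^ n • f, pow_smul_mem_of_smul_mem hFα n hfF, ?_⟩
  have e : α ^ n • f - (α ^ n • p + (α ^ n * l) • s) = α ^ n • (f - (p + l • s)) := by module
  rw [e, norm_smul, Real.norm_of_nonneg (by positivity)]
  calc α ^ n * ‖f - (p + l • s)‖ ≤ α ^ n * (ε * l) := by gcongr
    _ = _ := by ring

end Invariant

/-- A set invariant under `α`, `β` (multiplicatively independent) and the contractions towards
the basis vectors contains approximate copies of every finite set. -/
lemma containsApproxCopies_univ {d : ℕ} {F : Set (EuclideanSpace ℝ (Fin d))} {α β γ : ℝ}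
    (hα : 0 < α) (hβ : 0 < β) (hγ : 0 < γ) (hγ1 : γ < 1)
    (hirr : Irrational (Real.log β / Real.log α)) (hFne : F.Nonempty)
    (hFα : ∀ f ∈ F, α • f ∈ F) (hFβ : ∀ f ∈ F, β • f ∈ F)
    (hFγ : ∀ i, ∀ f ∈ F, γ • f + (1 - γ) • EuclideanSpace.single i (1 : ℝ) ∈ F) :
    ContainsApproxCopies F univ := by
  classical
  have h : ∀ I : Finset (Fin d), ContainsApproxCopies F
      {x | ∃ v ∈ {v : EuclideanSpace ℝ (Fin d) | ∀ i ∉ I, v i = 0}, ∃ f ∈ F, x = v + f} := by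
    intro I
    induction I using Finset.induction_on with
    | empty =>
      intro S hS ε hε
      refine ⟨1, one_pos, 0, fun s hs => ?_⟩
      obtain ⟨v, hv, f, hf, rfl⟩ := hS s hs
      have : v = 0 := by ext i; simpa using hv i (by simp)
      exact ⟨f, hf, by simp [this, hε.le]⟩
    | insert i I hi ih =>
      have := ContainsApproxCopies.add_line hα hβ hγ hγ1 hirr hFα hFβ (hFγ i)
        (by
          intro v hv l _ j hj
          simp [hv j hj]) ih
      intro S hS
      refine this S fun s hs => ?_
      obtain ⟨v, hv, f, hf, rfl⟩ := hS s hs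
      refine ⟨v - v i • EuclideanSpace.single i (1 : ℝ), ?_, v i, f, hf, by simp⟩
      intro j hj
      by_cases hji : j = i
      · subst hji; simp
      · have := hv j (by simp [hji, hj])
        simp [this, hji]
  obtain ⟨f, hf⟩ := hFne
  intro S _
  exact h Finset.univ S fun s _ => ⟨s - f, by simp, f, hf, by simp⟩

lemma isCompact_unitCube (d : ℕ) :
    IsCompact {x : EuclideanSpace ℝ (Fin d) | ∀ i, x i ∈ Set.Icc (0 : ℝ) 1} := by
  have h : IsCompact (Set.univ.pi fun _ : Fin d => Set.Icc (0 : ℝ) 1) :=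
    isCompact_univ_pi fun _ => isCompact_Icc
  have := (EuclideanSpace.equiv (Fin d) ℝ).toHomeomorph.isCompact_preimage.2 h
  convert this using 1
  ext x
  exact ⟨fun hx i _ => hx i, fun hx i => hx i (mem_univ i)⟩

/-- If `F` approximately contains copies of all finite sets, then suitable magnifications of `F`
are Hausdorff-close to the unit cube inside the unit cube. -/
lemma ContainsApproxCopies.exists_hausdorffDist_le {d : ℕ}
    {F : Set (EuclideanSpace ℝ (Fin d))} (h : ContainsApproxCopies F univ) {δ : ℝ}
    (hδ : 0 < δ) :
    ∃ (T : EuclideanSpace ℝ (Fin d) → EuclideanSpace ℝ (Fin d)) (u : ℝ), 0 < u ∧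
      (∀ x y, dist (T x) (T y) = u * dist x y) ∧
      Metric.hausdorffDist
        (T '' F ∩ {x : EuclideanSpace ℝ (Fin d) | ∀ i, x i ∈ Set.Icc (0 : ℝ) 1})
        {x : EuclideanSpace ℝ (Fin d) | ∀ i, x i ∈ Set.Icc (0 : ℝ) 1} ≤ δ := by
  classical
  set X := {x : EuclideanSpace ℝ (Fin d) | ∀ i, x i ∈ Set.Icc (0 : ℝ) 1} with hX
  set e : EuclideanSpace ℝ (Fin d) := WithLp.toLp 2 fun _ => (1 : ℝ) with he
  obtain ⟨C, hC⟩ := ((isCompact_unitCube d).image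
    (show Continuous fun y => e - (2 : ℝ) • y by fun_prop)).isBounded.exists_norm_le
  have hCX : ∀ y ∈ X, ‖e - (2 : ℝ) • y‖ ≤ C := fun y hy => hC _ ⟨y, hy, rfl⟩
  have hC0 : 0 ≤ C := (norm_nonneg _).trans (hCX 0 (by simp [hX]))
  set ε := min (1 / 2) (δ / (C + 2)) with hεdef
  have hε : 0 < ε := by positivity
  have hε1 : ε ≤ 1 / 2 := min_le_left _ _
  have hε2 : ε * (C + 2) ≤ δ := (le_div_iff₀ (by positivity)).1 (min_le_right _ _)
  obtain ⟨Y, hYX, hYfin, hY⟩ := (isCompact_unitCube d).finite_cover_balls hε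
  set φ : EuclideanSpace ℝ (Fin d) → EuclideanSpace ℝ (Fin d) :=
    fun y => y + ε • (e - (2 : ℝ) • y) with hφ
  obtain ⟨l, hl, p, hf⟩ := h (hYfin.toFinset.image φ) (fun _ _ => mem_univ _) ε hε
  refine ⟨fun x => l⁻¹ • (x - p), l⁻¹, by positivity, fun x y => ?_, ?_⟩
  · rw [dist_smul₀, dist_sub_right, Real.norm_of_nonneg (by positivity)]
  refine Metric.hausdorffDist_le_of_mem_dist hδ.le
    (fun x hx => ⟨x, hx.2, by simpa using hδ.le⟩) fun x hx => ?_
  obtain ⟨y, hyY, hxy⟩ := mem_iUnion₂.1 (hY hx)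
  obtain ⟨f, hfF, hfn⟩ := hf (φ y) (Finset.mem_image_of_mem _ (hYfin.mem_toFinset.2 hyY))
  have hyX : y ∈ X := hYX hyY
  have hn : ‖l⁻¹ • (f - p) - φ y‖ ≤ ε := by
    have e1 : l⁻¹ • (f - p) - φ y = l⁻¹ • (f - (p + l • φ y)) := by
      rw [← sub_sub f p, smul_sub l⁻¹ (f - p), smul_smul, inv_mul_cancel₀ hl.ne', one_smul]
    rw [e1, norm_smul, Real.norm_of_nonneg (by positivity), inv_mul_le_iff₀ hl, mul_comm]
    exact hfn
  refine ⟨l⁻¹ • (f - p), ⟨⟨f, hfF, rfl⟩, fun i => ?_⟩, ?_⟩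
  · have h1 := (PiLp.norm_apply_le (l⁻¹ • (f - p) - φ y) i).trans hn
    have h2 : φ y i = y i + ε * (1 - 2 * y i) := by simp [hφ, he]
    rw [PiLp.sub_apply, h2, Real.norm_eq_abs, abs_le] at h1
    obtain ⟨h3, h4⟩ := hyX i
    constructor <;> nlinarith
  · have h1 : dist (φ y) y ≤ ε * C := by
      rw [dist_eq_norm]
      simp only [hφ, add_sub_cancel_left, norm_smul, Real.norm_of_nonneg hε.le]
      gcongr
      exact hCX y hyX
    have h3 := dist_triangle x y (l⁻¹ • (f - p))
    have h4 := dist_triangle y (φ y) (l⁻¹ • (f - p))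
    rw [← dist_eq_norm, dist_comm] at hn
    rw [dist_comm] at h1
    have := mem_ball.1 hxy
    linarith

/-- A ball of radius `r` in `ℝ^d` is covered by `O((r / ρ) ^ d)` balls of radius `ρ`. -/
lemma exists_cover_ball_card_le (d : ℕ) {r ρ : ℝ} (hρ : 0 < ρ) (hr : ρ < r)
    (x : EuclideanSpace ℝ (Fin d)) :
    ∃ t : Finset (EuclideanSpace ℝ (Fin d)),
      Metric.ball x r ⊆ ⋃ y ∈ t, Metric.ball y ρ ∧
      (t.card : ℝ) ≤ (2 * d + 5 : ℝ) ^ d * (r / ρ) ^ d := by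
  classical
  set h : ℝ := ρ / (d + 1) with hh
  have hh0 : 0 < h := by positivity
  have hr0 : 0 < r := hρ.trans hr
  set N : ℕ := ⌈r / h⌉₊ with hN
  set ψ : (Fin d → ℤ) → EuclideanSpace ℝ (Fin d) :=
    fun k => x + WithLp.toLp 2 fun i => h * (k i : ℝ) with hψ
  refine ⟨(Fintype.piFinset fun _ : Fin d => Finset.Icc (-(N : ℤ)) N).image ψ, ?_, ?_⟩
  · intro y hy
    have hyi : ∀ i, |y i - x i| < r := fun i => by
      have h1 := PiLp.norm_apply_le (y - x) i
      rw [PiLp.sub_apply, Real.norm_eq_abs, ← dist_eq_norm] at h1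
      exact h1.trans_lt hy
    set k : Fin d → ℤ := fun i => ⌊(y i - x i) / h⌋ with hk
    have hkr : ∀ i, |(y i - x i) / h| ≤ N := fun i => by
      rw [abs_div, abs_of_pos hh0]
      exact (div_le_div_of_nonneg_right (hyi i).le hh0.le).trans (Nat.le_ceil _)
    refine mem_iUnion₂.2 ⟨ψ k, Finset.mem_image_of_mem _ ?_, ?_⟩
    · rw [Fintype.mem_piFinset]
      intro i
      obtain ⟨h1, h2⟩ := abs_le.1 (hkr i)
      rw [Finset.mem_Icc]
      constructor
      · rw [hk, Int.le_floor]; push_cast; exact h1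
      · have h3 : ((k i : ℤ) : ℝ) ≤ N := (Int.floor_le ((y i - x i) / h)).trans h2
        exact_mod_cast h3
    · rw [mem_ball, dist_eq_norm]
      have hb : ∀ i, |(y - ψ k) i| ≤ h := fun i => by
        have h1 := Int.floor_le ((y i - x i) / h)
        have h2 := (Int.lt_floor_add_one ((y i - x i) / h)).le
        rw [le_div_iff₀ hh0] at h1
        rw [div_le_iff₀ hh0] at h2
        have h3 : (y - ψ k) i = y i - x i - h * ⌊(y i - x i) / h⌋ := by
          simp [hψ, hk]; ring
        rw [h3, abs_le]
        constructor <;> nlinarith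
      have h1 : ‖y - ψ k‖ ^ 2 ≤ d * h ^ 2 := by
        rw [EuclideanSpace.norm_sq_eq]
        calc _ ≤ ∑ _i : Fin d, h ^ 2 := Finset.sum_le_sum fun i _ => by
              rw [Real.norm_eq_abs]; exact pow_le_pow_left₀ (abs_nonneg _) (hb i) 2
          _ = _ := by simp
      have h2 : ρ = (d + 1) * h := by rw [hh]; field_simp
      refine lt_of_pow_lt_pow_left₀ 2 hρ.le (h1.trans_lt ?_)
      rw [h2]
      have : 0 < h ^ 2 := by positivity
      have hd : (0 : ℝ) ≤ d := Nat.cast_nonneg d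
      nlinarith [mul_nonneg hd this.le, mul_nonneg (mul_nonneg hd hd) this.le]
  · have h1 : ((Fintype.piFinset fun _ : Fin d => Finset.Icc (-(N : ℤ)) N).image ψ).card
        ≤ (2 * N + 1) ^ d := by
      refine Finset.card_image_le.trans ?_
      rw [Fintype.card_piFinset]
      simp only [Int.card_Icc, Finset.prod_const, Finset.card_univ, Fintype.card_fin]
      exact Nat.pow_le_pow_left (by omega) d
    calc _ ≤ (((2 * N + 1) ^ d : ℕ) : ℝ) := by exact_mod_cast h1
      _ = (2 * N + 1 : ℝ) ^ d := by push_cast; rfl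
      _ ≤ ((2 * d + 5) * (r / ρ)) ^ d := by
        refine pow_le_pow_left₀ (by positivity) ?_ d
        have h2 : (N : ℝ) < r / h + 1 := Nat.ceil_lt_add_one (by positivity)
        have h3 : r / h = (d + 1) * (r / ρ) := by rw [hh]; field_simp
        have h4 : 1 < r / ρ := (one_lt_div hρ).2 hr
        nlinarith
      _ = _ := mul_pow _ _ _

/-- If small approximate copies of all finite sets are contained in `F`, then any exponent
admissible for the Assouad dimension of `F` is at least `d`. -/
lemma le_exponent_of_approxCopies {d : ℕ} (hd : d ≠ 0)
    {F : Set (EuclideanSpace ℝ (Fin d))}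
    (h : ∀ S : Finset (EuclideanSpace ℝ (Fin d)), ∀ η : ℝ, 0 < η → ∃ l : ℝ, 0 < l ∧ l ≤ η ∧
      ∃ p, ∀ s ∈ S, ∃ f ∈ F, ‖f - (p + l • s)‖ ≤ 1 / 4 * l)
    {s K : ℝ}
    (hcov : ∀ r ρ : ℝ, 0 < ρ → ρ < r → r ≤ 1 → ∀ x ∈ F,
      ∃ t : Finset (EuclideanSpace ℝ (Fin d)),
        (F ∩ Metric.ball x r ⊆ ⋃ y ∈ t, Metric.ball y ρ) ∧ (t.card : ℝ) ≤ K * (r / ρ) ^ s) :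
    (d : ℝ) ≤ s := by
  classical
  have hd1 : (1 : ℝ) ≤ d := by exact_mod_cast Nat.one_le_iff_ne_zero.2 hd
  have key : ∀ N : ℕ, 1 ≤ N → (N : ℝ) ^ d ≤ K * (8 * d * N) ^ s := by
    intro N hN
    have hN1 : (1 : ℝ) ≤ N := by exact_mod_cast hN
    set ψ : (Fin d → Fin N) → EuclideanSpace ℝ (Fin d) :=
      fun k => WithLp.toLp 2 fun i => ((k i : ℕ) : ℝ) with hψ
    obtain ⟨l, hl, hlη, p, hf⟩ := h (Finset.univ.image ψ) (1 / (2 * d * N)) (by positivity)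
    have hf' : ∀ k, ∃ f ∈ F, ‖f - (p + l • ψ k)‖ ≤ 1 / 4 * l := fun k =>
      hf _ (Finset.mem_image_of_mem _ (Finset.mem_univ k))
    choose f hfF hfn using hf'
    have hdiff : ∀ k k', ‖(f k - f k') - l • (ψ k - ψ k')‖ ≤ 1 / 2 * l := fun k k' => by
      have e : (f k - f k') - l • (ψ k - ψ k')
          = (f k - (p + l • ψ k)) - (f k' - (p + l • ψ k')) := by module
      rw [e]
      refine (norm_sub_le _ _).trans ?_
      linarith [hfn k, hfn k']
    have hsep : ∀ k k', k ≠ k' → 1 / 2 * l ≤ dist (f k) (f k') := fun k k' hne => by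
      obtain ⟨i, hi⟩ := Function.ne_iff.1 hne
      have h1 : (1 : ℝ) ≤ ‖ψ k - ψ k'‖ := by
        refine le_trans ?_ (PiLp.norm_apply_le (ψ k - ψ k') i)
        have h2 : ((k i : ℕ) : ℤ) - ((k' i : ℕ) : ℤ) ≠ 0 := by
          intro h0; apply hi; ext; omega
        have h3 := Int.one_le_abs h2
        have h4 : (ψ k - ψ k') i = ((((k i : ℕ) : ℤ) - ((k' i : ℕ) : ℤ) : ℤ) : ℝ) := by
          simp [hψ]
        rw [h4, Real.norm_eq_abs]
        exact_mod_cast h3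
      have h2 : l ≤ ‖l • (ψ k - ψ k')‖ := by
        rw [norm_smul, Real.norm_of_nonneg hl.le]; nlinarith
      have h3 := norm_sub_norm_le (l • (ψ k - ψ k')) (f k - f k')
      rw [norm_sub_rev (l • _)] at h3
      rw [dist_eq_norm]
      linarith [hdiff k k']
    have hclose : ∀ k k', dist (f k) (f k') < l * (2 * d * N) := fun k k' => by
      have h1 : ‖ψ k - ψ k'‖ ≤ d * N := by
        refine (pow_le_pow_iff_left₀ (norm_nonneg _) (by positivity) two_ne_zero).1 ?_
        rw [EuclideanSpace.norm_sq_eq]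
        calc _ ≤ ∑ _i : Fin d, (N : ℝ) ^ 2 := Finset.sum_le_sum fun i _ => by
              refine pow_le_pow_left₀ (norm_nonneg _) ?_ 2
              have h1 : ((k i : ℕ) : ℝ) ≤ N := by exact_mod_cast (k i).2.le
              have h2 : ((k' i : ℕ) : ℝ) ≤ N := by exact_mod_cast (k' i).2.le
              have h3 : (0 : ℝ) ≤ ((k i : ℕ) : ℝ) := Nat.cast_nonneg _
              have h4 : (0 : ℝ) ≤ ((k' i : ℕ) : ℝ) := Nat.cast_nonneg _
              have h5 : (ψ k - ψ k') i = ((k i : ℕ) : ℝ) - ((k' i : ℕ) : ℝ) := by simp [hψ]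
              rw [h5, Real.norm_eq_abs, abs_le]
              constructor <;> linarith
          _ = d * (N : ℝ) ^ 2 := by simp
          _ ≤ (d * N) ^ 2 := by
            rw [mul_pow]; gcongr; nlinarith
      have h2 := norm_sub_norm_le (f k - f k') (l • (ψ k - ψ k'))
      rw [norm_smul, Real.norm_of_nonneg hl.le] at h2
      rw [dist_eq_norm]
      have h3 : l * ‖ψ k - ψ k'‖ ≤ l * (d * N) := by gcongr
      have h4 : l * 1 ≤ l * (d * N) := by gcongr; nlinarith
      linarith [hdiff k k']
    have hr1 : l * (2 * d * N) ≤ 1 := (le_div_iff₀ (by positivity)).1 hlη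
    have hNpos : 0 < N := hN
    set k₀ : Fin d → Fin N := fun _ => ⟨0, hNpos⟩
    have hdN : 1 ≤ (d : ℝ) * N := by nlinarith
    obtain ⟨t, ht, htc⟩ := hcov (l * (2 * d * N)) (1 / 4 * l) (by positivity)
      (by nlinarith) hr1 (f k₀) (hfF k₀)
    have hg : ∀ k, ∃ y ∈ t, f k ∈ Metric.ball y (1 / 4 * l) := fun k => by
      simpa using ht ⟨hfF k, mem_ball.2 (hclose k k₀)⟩
    choose g hgt hgb using hg
    have hinj : Function.Injective g := by
      intro k k' hkk
      by_contra hne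
      have h1 := hsep k k' hne
      have h2 := mem_ball.1 (hgb k)
      have h3 := mem_ball.1 (hgb k')
      rw [← hkk] at h3
      have h4 := dist_triangle_right (f k) (f k') (g k)
      linarith
    have hcard : N ^ d ≤ t.card := by
      have := Finset.card_le_card_of_injOn (s := Finset.univ) g (fun k _ => hgt k)
        hinj.injOn
      simpa using this
    have e : l * (2 * d * N) / (1 / 4 * l) = 8 * d * N := by field_simp; norm_num
    rw [e] at htc
    refine le_trans ?_ htc
    exact_mod_cast hcard
  by_contra! hlt
  have htend : Tendsto (fun N : ℕ => (N : ℝ) ^ ((d : ℝ) - s)) atTop atTop :=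
    (tendsto_rpow_atTop (by linarith)).comp tendsto_natCast_atTop_atTop
  obtain ⟨N, hN, hN1⟩ := ((htend.eventually_gt_atTop (K * (8 * d) ^ s)).and
    (eventually_ge_atTop 1)).exists
  have hN0 : (0 : ℝ) < N := by exact_mod_cast hN1
  have h1 := key N hN1
  rw [Real.mul_rpow (by positivity) hN0.le, ← mul_assoc] at h1
  rw [Real.rpow_sub hN0, Real.rpow_natCast, lt_div_iff₀ (by positivity)] at hN
  linarith

/-- **A self-similar set in `ℝ^d` with small Hausdorff dimension and full Assouad
dimension.**  Let `Λ = {0,1}^d` be the corners of `[0,1]^d` and `α, β, γ ∈ (0,1)` with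
`log β / log α` irrational.  Let `F ⊆ [0,1]^d` be the attractor of the `1 + 2^d` maps
`x ↦ αx`, `x ↦ βx` and `x ↦ γx + (1-γ)z` for `z ∈ Λ \ {0}`.  Then `[0,1]^d` is a weak
tangent of `F` (with reference set `X = [0,1]^d`), and consequently `dim_A F = d`. -/
theorem full_assouad_dimension_example {d : ℕ} (α β γ : ℝ)
    (hα : α ∈ Set.Ioo (0 : ℝ) 1) (hβ : β ∈ Set.Ioo (0 : ℝ) 1) (hγ : γ ∈ Set.Ioo (0 : ℝ) 1)
    (hirr : Irrational (Real.log β / Real.log α))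
    (F : Set (EuclideanSpace ℝ (Fin d))) (hFcomp : IsCompact F) (hFne : F.Nonempty)
    (hFsub : F ⊆ {x : EuclideanSpace ℝ (Fin d) | ∀ i, x i ∈ Set.Icc (0 : ℝ) 1})
    (hFattr : F = (fun x => α • x) '' F ∪ (fun x => β • x) '' F ∪
      ⋃ z ∈ {z : EuclideanSpace ℝ (Fin d) | (∀ i, z i = 0 ∨ z i = 1) ∧ z ≠ 0},
        (fun x => γ • x + (1 - γ) • z) '' F) :
    (∃ (T : ℕ → EuclideanSpace ℝ (Fin d) → EuclideanSpace ℝ (Fin d)) (u : ℕ → ℝ),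
      (∀ k, 0 < u k) ∧ (∀ k x y, dist (T k x) (T k y) = u k * dist x y) ∧
      Tendsto (fun k => Metric.hausdorffDist
          (T k '' F ∩ {x : EuclideanSpace ℝ (Fin d) | ∀ i, x i ∈ Set.Icc (0 : ℝ) 1})
          {x : EuclideanSpace ℝ (Fin d) | ∀ i, x i ∈ Set.Icc (0 : ℝ) 1})
        atTop (nhds 0)) ∧
    assouadDim F = d := by
  have hFα : ∀ f ∈ F, α • f ∈ F := fun f hf => by
    rw [hFattr]; exact Or.inl (Or.inl ⟨f, hf, rfl⟩)
  have hFβ : ∀ f ∈ F, β • f ∈ F := fun f hf => by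
    rw [hFattr]; exact Or.inl (Or.inr ⟨f, hf, rfl⟩)
  have hFγ : ∀ i, ∀ f ∈ F, γ • f + (1 - γ) • EuclideanSpace.single i (1 : ℝ) ∈ F := by
    intro i f hf
    rw [hFattr]
    refine Or.inr (mem_iUnion₂.2 ⟨EuclideanSpace.single i 1, ⟨fun j => ?_, ?_⟩, f, hf, rfl⟩)
    · by_cases hji : j = i <;> simp [hji]
    · intro h0
      simpa using congrArg (fun v : EuclideanSpace ℝ (Fin d) => v i) h0
  have hcopies : ContainsApproxCopies F univ :=
    containsApproxCopies_univ hα.1 hβ.1 hγ.1 hγ.2 hirr hFne hFα hFβ hFγ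
  constructor
  · choose T u hu hT hdist using fun k : ℕ =>
      hcopies.exists_hausdorffDist_le (Nat.one_div_pos_of_nat (α := ℝ) (n := k))
    exact ⟨T, u, hu, hT, squeeze_zero (fun _ => hausdorffDist_nonneg) hdist
      tendsto_one_div_add_atTop_nhds_zero_nat⟩
  · refine IsLeast.csInf_eq ⟨⟨Nat.cast_nonneg d, (2 * d + 5) ^ d, by positivity, ?_⟩, ?_⟩
    · intro r ρ hρ hr _ x _
      obtain ⟨t, ht, htc⟩ := exists_cover_ball_card_le d hρ hr x
      exact ⟨t, inter_subset_right.trans ht, by rwa [Real.rpow_natCast]⟩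
    · rintro s ⟨hs, K, -, hcov⟩
      rcases eq_or_ne d 0 with rfl | hd
      · simpa using hs
      · exact le_exponent_of_approxCopies hd
          (fun S η hη => hcopies.exists_scale_le hα.1 hα.2 hFα S (fun _ _ => mem_univ _)
            (by norm_num) hη) hcov
end
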